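/- Fix a real number T > 0 and an integer n ≥ 1, and let a = (a_1,…,a_n) be a tuple of admissible functions on [0,T]. If every moment of a vanishes, i.e., m^{n_1,…,n_j}_{i_1,…,i_{j+1}}(a) = 0 for all j ≥ 0, all positive integers n_1,…,n_j and all indices i_1,…,i_{j+1} ∈ {1,…,n}, then every basic iterated integral of a vanishes: I_{i_1,…,i_m}(a) = 0 for every m ≥ 1 and all indices i_1,…,i_m ∈ {1,…,n} (i.e., a is a universal center). -/

import Mathlib

open MeasureTheory Set Filter Topology

noncomputable section

/-- Iterated integral over the simplex `0 ≤ s₁ ≤ … ≤ s_m ≤ x`; the head of the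
list is attached to the outermost (largest) variable. -/
def simplexInt : List (ℝ → ℂ) → ℝ → ℂ
  | [] => fun _ => 1
  | f :: fs => fun x => ∫ s in (0:ℝ)..x, f s * simplexInt fs s

/-- The basic iterated integral `I_{i₁,…,i_m}(a)`. -/
def iterInt (T : ℝ) {n : ℕ} (a : Fin n → ℝ → ℂ) (l : List (Fin n)) : ℂ :=
  simplexInt ((l.map a).reverse) T

/-- `ã(x) = ∫_0^x a(s) ds`. -/
def primitive (a : ℝ → ℂ) (x : ℝ) : ℂ := ∫ s in (0:ℝ)..x, a s

/-- The moment `m^{n₁,…,n_j}_{i₁,…,i_{j+1}}(a)`, encoded by the list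
`ps = [(i₁,n₁),…,(i_j,n_j)]` of index/exponent pairs and the final index `i`. -/
def moment (T : ℝ) {n : ℕ} (a : Fin n → ℝ → ℂ) (ps : List (Fin n × ℕ)) (i : Fin n) : ℂ :=
  ∫ s in (0:ℝ)..T, (ps.map fun q => primitive (a q.1) s ^ q.2).prod * a i s

/-- A function is admissible if on `[0,T]` it is a polynomial in `x`
or a finite linear combination of the exponentials `e^{2πijx/T}`, `j ∈ ℤ`. -/
def Admissible (T : ℝ) (f : ℝ → ℂ) : Prop :=
  (∃ p : Polynomial ℂ, ∀ x ∈ Icc (0:ℝ) T, f x = p.eval (x : ℂ)) ∨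
  (∃ (s : Finset ℤ) (c : ℤ → ℂ), ∀ x ∈ Icc (0:ℝ) T,
    f x = ∑ j ∈ s, c j * Complex.exp (2 * (Real.pi : ℂ) * Complex.I * (j : ℂ) * (x : ℂ) / (T : ℂ)))

/-- The equation `dv/dx = Σ_{i=1}^n a_i(x) v^{i+1}` determines a center. -/
def DeterminesCenter (T : ℝ) {n : ℕ} (a : Fin n → ℝ → ℂ) : Prop :=
  ∃ ε > (0:ℝ), ∀ v : ℝ → ℂ,
    (∀ x ∈ Icc (0:ℝ) T, v x = v 0 + ∫ s in (0:ℝ)..x, ∑ i, a i s * v s ^ ((i : ℕ) + 2)) →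
    ‖v 0‖ < ε → v T = v 0

namespace MV
open LaurentPolynomial

section gen
variable {R : Type*} [CommRing R] [Algebra ℂ R]

/-- the derivation on Laurent polynomials in `z = e^{cs}` -/
def Dadd (δ : Derivation ℂ R R) (c : ℂ) : R[T;T⁻¹] →+ R[T;T⁻¹] :=
  (Finsupp.liftAddHom (fun j : ℤ =>
    ((AddMonoidAlgebra.singleAddHom j).comp
      ((δ : R →ₗ[ℂ] R) + (c * j) • LinearMap.id : R →ₗ[ℂ] R).toAddMonoidHom :
        R →+ R[T;T⁻¹]))).comp
    (AddMonoidAlgebra.coeffAddEquiv : R[T;T⁻¹] ≃+ (ℤ →₀ R)).toAddMonoidHom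

variable (δ : Derivation ℂ R R) (c : ℂ)

lemma Dadd_CT (p : R) (j : ℤ) : Dadd δ c (C p * T j) = C (δ p + (c * j) • p) * T j := by
  rw [← single_eq_C_mul_T, ← single_eq_C_mul_T]
  simp [Dadd, -single_eq_C_mul_T]

lemma smul_CT (a : ℂ) (p : R) (j : ℤ) : a • (C p * T j : R[T;T⁻¹]) = C (a • p) * T j := by
  rw [← single_eq_C_mul_T, ← single_eq_C_mul_T]
  simp [-single_eq_C_mul_T]

lemma Dadd_mul (v w : R[T;T⁻¹]) : Dadd δ c (v * w) = Dadd δ c v * w + v * Dadd δ c w := by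
  induction v using LaurentPolynomial.induction_on' with
  | add p q hp hq => simp only [add_mul, map_add, hp, hq]; ring
  | C_mul_T j p =>
    induction w using LaurentPolynomial.induction_on' with
    | add p q hp hq => simp only [mul_add, map_add, hp, hq]; ring
    | C_mul_T k q =>
      have h : (C p * T j * (C q * T k) : R[T;T⁻¹]) = C (p * q) * T (j + k) := by
        rw [T_add, map_mul]; ring
      rw [h, Dadd_CT, Dadd_CT, Dadd_CT, T_add]
      have : δ (p * q) + (c * ((j + k : ℤ) : ℂ)) • (p * q) = (δ p + (c * j) • p) * q + p * (δ q + (c * k) • q) := by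
        rw [Derivation.leibniz]
        simp only [Algebra.smul_def, Int.cast_add, map_mul, map_add, Algebra.algebraMap_self, RingHom.id_apply]
        ring
      rw [this, map_add, map_mul, map_mul]; ring

lemma Dadd_smul (a : ℂ) (v : R[T;T⁻¹]) : Dadd δ c (a • v) = a • Dadd δ c v := by
  induction v using LaurentPolynomial.induction_on' with
  | add p q hp hq => simp only [smul_add, map_add, hp, hq]
  | C_mul_T j p =>
    rw [smul_CT, Dadd_CT, Dadd_CT, smul_CT]
    congr 2
    rw [smul_add, smul_comm, Derivation.map_smul]

/-- the derivation as a linear map -/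
def D : R[T;T⁻¹] →ₗ[ℂ] R[T;T⁻¹] where
  toFun := Dadd δ c
  map_add' := map_add _
  map_smul' := Dadd_smul δ c

lemma D_CT (p : R) (j : ℤ) : D δ c (C p * T j) = C (δ p + (c * j) • p) * T j := Dadd_CT δ c p j
lemma D_mul (v w : R[T;T⁻¹]) : D δ c (v * w) = D δ c v * w + v * D δ c w := Dadd_mul δ c v w

lemma D_C (p : R) : D δ c (C p) = C (δ p) := by
  have := D_CT δ c p 0
  simpa using this

lemma D_one : D δ c 1 = 0 := by
  have := D_C δ c 1
  simpa using this

lemma D_algebraMap (a : ℂ) : D δ c (algebraMap ℂ _ a) = 0 := by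
  rw [Algebra.algebraMap_eq_smul_one, map_smul, D_one, smul_zero]

lemma coeff_CT (p : R) (j k : ℤ) : (C p * T j : R[T;T⁻¹]).coeff k = if j = k then p else 0 := by
  rw [← single_eq_C_mul_T]; simp [Finsupp.single_apply, -single_eq_C_mul_T]

lemma coeff_D (v : R[T;T⁻¹]) (j : ℤ) :
    (D δ c v).coeff j = δ (v.coeff j) + (c * j) • v.coeff j := by
  induction v using LaurentPolynomial.induction_on' with
  | add p q hp hq =>
    simp only [map_add, AddMonoidAlgebra.coeff_add, Finsupp.add_apply, hp, hq, smul_add]; abel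
  | C_mul_T k p =>
    rw [D_CT, coeff_CT, coeff_CT]
    split_ifs with h
    · rw [h]
    · simp

/-- chain rule for ring homs -/
lemma chain_rule {Ω : Type*} [CommRing Ω] [Algebra ℂ Ω] (d : Derivation ℂ Ω Ω)
    (φ : R[T;T⁻¹] →ₐ[ℂ] Ω) (w : Ω) (h1 : ∀ p : R, d (φ (C p)) = φ (C (δ p)) * w)
    (h2 : d (φ (T 1)) = c • (φ (T 1) * w)) (v : R[T;T⁻¹]) : d (φ v) = φ (D δ c v) * w := by
  have hT : ∀ j : ℤ, d (φ (T j)) = (c * j) • (φ (T j) * w) := by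
    have hinv : φ (T 1) * φ (T (-1)) = 1 := by rw [← map_mul, ← T_add]; simp
    have hm1 : d (φ (T (-1))) = (-c) • (φ (T (-1)) * w) := by
      have h3 : d (φ (T 1) * φ (T (-1))) = 0 := by rw [hinv]; simp
      rw [Derivation.leibniz, h2] at h3
      simp only [smul_eq_mul, Algebra.smul_def, map_neg] at h3 ⊢
      have h4 := congrArg (fun x => φ (T (-1)) * x) h3
      simp only [mul_zero] at h4
      linear_combination h4 - (d (φ (T (-1))) + algebraMap ℂ Ω c * φ (T (-1)) * w) * hinv 
    intro j
    induction j using Int.induction_on with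
    | zero => simp
    | succ i ih =>
      rw [T_add, map_mul, Derivation.leibniz, ih, h2]
      simp only [smul_eq_mul, Algebra.smul_def, Int.cast_add, Int.cast_one, map_mul, map_add, map_one]; ring
    | pred i ih =>
      rw [sub_eq_add_neg, T_add, map_mul, Derivation.leibniz, ih, hm1]
      simp only [smul_eq_mul, Algebra.smul_def, Int.cast_add, Int.cast_neg, Int.cast_one, map_mul, map_add, map_one, map_neg]; ring
  induction v using LaurentPolynomial.induction_on' with
  | add p q hp hq => simp only [map_add, hp, hq, add_mul]
  | C_mul_T j p =>
    rw [D_CT, map_mul, Derivation.leibniz, hT, h1, map_mul φ, map_add C, map_add φ]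
    have : φ (C ((c * j) • p)) = (c * j) • φ (C p) := by
      rw [← map_smul]; congr 1
      have := smul_CT (c * j) p 0
      simpa using this.symm
    rw [this]
    simp only [smul_eq_mul, Algebra.smul_def]; ring

end gen
end MV

namespace MV

lemma kappa {V Ω : Type*} [CommRing V] [IsDomain V] [Algebra ℂ V] [CommRing Ω] [Algebra ℂ Ω]
    (R : Subalgebra ℂ V) (F : V) (hF : IsAlgebraic R F) (φ0 φ1 : V →ₐ[ℂ] Ω)
    (hinj : Function.Injective φ0) (hR : ∀ r ∈ R, φ0 r = φ1 r) (κ : ℂ)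
    (h : φ1 F = φ0 F + algebraMap ℂ Ω κ) : κ = 0 := by
  obtain ⟨p, hp0, hp⟩ := hF
  by_contra hκ
  have key : ∀ k : ℕ, Polynomial.aeval (F + k * algebraMap ℂ V κ) p = 0 := by
    intro k
    induction k with
    | zero => simpa using hp
    | succ k ih =>
      have e1 : φ1 (F + k * algebraMap ℂ V κ) = φ0 (F + (k + 1 : ℕ) * algebraMap ℂ V κ) := by
        simp [h]; ring
      apply hinj
      rw [map_zero]
      have e2 := congrArg φ1 ih
      rw [map_zero, Polynomial.aeval_eq_sum_range, map_sum] at e2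
      rw [Polynomial.aeval_eq_sum_range, map_sum, ← e2]
      refine Finset.sum_congr rfl fun i _ => ?_
      rw [Subalgebra.smul_def, Subalgebra.smul_def, smul_eq_mul, smul_eq_mul, map_mul, map_mul,
        map_pow, map_pow, e1, hR _ (p.coeff i).2]
  have hinj' : Function.Injective (algebraMap R V) := Subtype.val_injective
  have hq : p.map (algebraMap R V) ≠ 0 := (Polynomial.map_ne_zero_iff hinj').2 hp0
  apply hq
  apply Polynomial.eq_zero_of_infinite_isRoot
  refine Set.infinite_of_injective_forall_mem (f := fun k : ℕ => F + k * algebraMap ℂ V κ) ?_ ?_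
  · intro i j hij
    simp only [add_right_inj] at hij
    have hc : algebraMap ℂ V (i * κ) = algebraMap ℂ V (j * κ) := by simpa using hij
    have := (algebraMap ℂ V).injective hc
    exact_mod_cast mul_right_cancel₀ hκ this
  · intro k
    have := key k
    rw [Polynomial.aeval_def, Polynomial.eval₂_eq_eval_map] at this
    exact this

open Polynomial in
theorem hensel_gen (R : Type*) [CommRing R] (I : Ideal R)
    [IsAdicComplete I R] (f : R[X]) (a₀ : R) (h₁ : f.eval a₀ ∈ I)
    (h₂ : IsUnit (Ideal.Quotient.mk I (f.derivative.eval a₀))) :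
    ∃ a : R, f.IsRoot a ∧ a - a₀ ∈ I := by
    classical
      let f' := derivative f
      let c : ℕ → R := fun n => Nat.recOn n a₀ fun _ b => b - f.eval b * Ring.inverse (f'.eval b)
      have hc : ∀ n, c (n + 1) = c n - f.eval (c n) * Ring.inverse (f'.eval (c n)) := by
        intro n
        simp only [c]
      have hc_mod : ∀ n, c n ≡ a₀ [SMOD I] := by
        intro n
        induction n with
        | zero => rfl
        | succ n ih => ?_
        rw [hc, sub_eq_add_neg, ← add_zero a₀]
        refine ih.add ?_
        rw [SModEq.zero, Ideal.neg_mem_iff]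
        refine I.mul_mem_right _ ?_
        rw [← SModEq.zero] at h₁ ⊢
        exact (ih.eval f).trans h₁
      have hf'c : ∀ n, IsUnit (f'.eval (c n)) := by
        intro n
        have := isLocalHom_of_le_jacobson_bot I (IsAdicComplete.le_jacobson_bot I)
        apply IsUnit.of_map (Ideal.Quotient.mk I)
        convert! h₂ using 1
        exact SModEq.def.mp ((hc_mod n).eval _)
      have hfcI : ∀ n, f.eval (c n) ∈ I ^ (n + 1) := by
        intro n
        induction n with
        | zero => simpa only [Nat.rec_zero, zero_add, pow_one] using! h₁
        | succ n ih => ?_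
        rw [← taylor_eval_sub (c n), hc, sub_eq_add_neg, sub_eq_add_neg,
          add_neg_cancel_comm]
        rw [eval_eq_sum, sum_over_range' _ _ _ (lt_add_of_pos_right _ zero_lt_two), ←
          Finset.sum_range_add_sum_Ico _ (Nat.le_add_left _ _)]
        swap
        · intro i
          rw [zero_mul]
        refine Ideal.add_mem _ ?_ ?_
        · rw [← one_add_one_eq_two, Finset.sum_range_succ, Finset.range_one, Finset.sum_singleton,
            taylor_coeff_zero, taylor_coeff_one, pow_zero, pow_one, mul_one, mul_neg,
            mul_left_comm, Ring.mul_inverse_cancel _ (hf'c n), mul_one, add_neg_cancel]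
          exact Ideal.zero_mem _
        · refine Submodule.sum_mem _ ?_
          simp only [Finset.mem_Ico]
          rintro i ⟨h2i, _⟩
          have aux : n + 2 ≤ i * (n + 1) := by trans 2 * (n + 1) <;> nlinarith only [h2i]
          refine Ideal.mul_mem_left _ _ (Ideal.pow_le_pow_right aux ?_)
          rw [pow_mul']
          exact Ideal.pow_mem_pow ((Ideal.neg_mem_iff _).2 <| Ideal.mul_mem_right _ _ ih) _
      have aux : ∀ m n, m ≤ n → c m ≡ c n [SMOD (I ^ m • ⊤ : Ideal R)] := by
        intro m n hmn
        rw [← Ideal.one_eq_top, Ideal.smul_eq_mul, mul_one]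
        obtain ⟨k, rfl⟩ := Nat.exists_eq_add_of_le hmn
        clear hmn
        induction k with
        | zero => rw [add_zero]
        | succ k ih => ?_
        rw [← add_assoc, hc, ← add_zero (c m), sub_eq_add_neg]
        refine ih.add ?_
        symm
        rw [SModEq.zero, Ideal.neg_mem_iff]
        refine Ideal.mul_mem_right _ _ (Ideal.pow_le_pow_right ?_ (hfcI _))
        rw [add_assoc]
        exact le_self_add
      obtain ⟨a, ha⟩ := IsPrecomplete.prec' c (aux _ _)
      refine ⟨a, ?_, ?_⟩
      · show f.IsRoot a
        suffices ∀ n, f.eval a ≡ 0 [SMOD (I ^ n • ⊤ : Ideal R)] by exact IsHausdorff.haus' _ this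
        intro n
        specialize ha n
        rw [← Ideal.one_eq_top, Ideal.smul_eq_mul, mul_one] at ha ⊢
        refine (ha.symm.eval f).trans ?_
        rw [SModEq.zero]
        exact Ideal.pow_le_pow_right le_self_add (hfcI _)
      · show a - a₀ ∈ I
        specialize ha (0 + 1)
        rw [hc, pow_one, ← Ideal.one_eq_top, Ideal.smul_eq_mul, mul_one, sub_eq_add_neg] at ha
        rw [← SModEq.sub_mem, ← add_zero a₀]
        refine ha.symm.trans (SModEq.rfl.add ?_)
        rw [SModEq.zero, Ideal.neg_mem_iff]
        exact Ideal.mul_mem_right _ _ h₁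

open PowerSeries in
theorem hensel_ps (f : Polynomial ℂ⟦X⟧) (y : ℂ)
    (h1 : constantCoeff (f.eval (PowerSeries.C y)) = 0)
    (h2 : constantCoeff (f.derivative.eval (PowerSeries.C y)) ≠ 0) :
    ∃ b : ℂ⟦X⟧, f.eval b = 0 ∧ constantCoeff b = y := by
  obtain ⟨a, ha, ha'⟩ := hensel_gen ℂ⟦X⟧ (Ideal.span {X}) f (PowerSeries.C y)
    (by rw [Ideal.mem_span_singleton, X_dvd_iff, h1])
    (by
      apply IsUnit.map
      rw [PowerSeries.isUnit_iff_constantCoeff]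
      exact isUnit_iff_ne_zero.2 h2)
  refine ⟨a, ha, ?_⟩
  rw [Ideal.mem_span_singleton, X_dvd_iff, map_sub, constantCoeff_C, sub_eq_zero] at ha'
  exact ha'

open PowerSeries in
/-- solve `b^e k(t^r b) = 1` -/
theorem solveA (k : Polynomial ℂ) (hk : k.eval 0 ≠ 0) (e r : ℕ) (he : 0 < e) (hr : 0 < r) :
    ∃ b : ℂ⟦X⟧, constantCoeff b ≠ 0 ∧ b ^ e * Polynomial.aeval (X ^ r * b) k = 1 := by
  obtain ⟨y, hy⟩ := IsAlgClosed.exists_pow_nat_eq ((k.eval 0)⁻¹) he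
  have hy0 : y ≠ 0 := by
    rintro rfl
    rw [zero_pow he.ne'] at hy
    exact hk (inv_eq_zero.1 hy.symm)
  set q : Polynomial ℂ⟦X⟧ := (k.map (algebraMap ℂ ℂ⟦X⟧)).comp (Polynomial.C (X ^ r) * Polynomial.X) with hq
  have hqe : ∀ b, q.eval b = Polynomial.aeval (X ^ r * b) k := by
    intro b
    simp [hq, Polynomial.eval_comp, Polynomial.aeval_def, Polynomial.eval₂_eq_eval_map]
  have hcc : ∀ b, constantCoeff (Polynomial.aeval (X ^ r * b : ℂ⟦X⟧) k) = k.eval 0 := by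
    intro b
    rw [Polynomial.aeval_def, Polynomial.hom_eval₂]
    simp [hr.ne', Polynomial.eval₂_eq_eval_map]
  obtain ⟨b, hb, hby⟩ := hensel_ps (Polynomial.X ^ e * q - 1) y
    (by
      simp only [Polynomial.eval_sub, Polynomial.eval_mul, Polynomial.eval_pow, Polynomial.eval_X,
        Polynomial.eval_one, hqe, map_sub, map_mul, map_pow, hcc, map_one, constantCoeff_C, hy]
      rw [inv_mul_cancel₀ hk, sub_self])
    (by
      have : constantCoeff (q.derivative.eval (PowerSeries.C y)) = 0 := by
        rw [hq, Polynomial.derivative_comp, Polynomial.derivative_C_mul, Polynomial.derivative_X,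
          mul_one, Polynomial.eval_mul, Polynomial.eval_C, map_mul, map_pow, constantCoeff_X,
          zero_pow hr.ne', zero_mul]
      simp only [Polynomial.derivative_sub, Polynomial.derivative_mul, Polynomial.eval_sub,
        Polynomial.eval_add, Polynomial.eval_mul, Polynomial.derivative_X_pow, Polynomial.eval_pow,
        Polynomial.eval_X, hqe, map_sub, map_mul, map_add, map_pow, hcc, constantCoeff_C, this,
        Polynomial.derivative_one, Polynomial.eval_zero, Polynomial.eval_C, map_zero, mul_zero,
        add_zero, sub_zero, Polynomial.eval_natCast, map_natCast]
      refine mul_ne_zero (mul_ne_zero ?_ (pow_ne_zero _ hy0)) hk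
      exact_mod_cast he.ne')
  refine ⟨b, hby ▸ hy0, ?_⟩
  rw [← hqe]
  simpa [sub_eq_zero] using hb

open PowerSeries in
/-- solve `k(t^r b) = b^e` -/
theorem solveL (k : Polynomial ℂ) (hk : k.eval 0 ≠ 0) (e r : ℕ) (he : 0 < e) (hr : 0 < r) :
    ∃ b : ℂ⟦X⟧, constantCoeff b ≠ 0 ∧ Polynomial.aeval (X ^ r * b) k = b ^ e := by
  obtain ⟨y, hy⟩ := IsAlgClosed.exists_pow_nat_eq (k.eval 0) he
  have hy0 : y ≠ 0 := by
    rintro rfl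
    rw [zero_pow he.ne'] at hy
    exact hk hy.symm
  set q : Polynomial ℂ⟦X⟧ := (k.map (algebraMap ℂ ℂ⟦X⟧)).comp (Polynomial.C (X ^ r) * Polynomial.X) with hq
  have hqe : ∀ b, q.eval b = Polynomial.aeval (X ^ r * b) k := by
    intro b
    simp [hq, Polynomial.eval_comp, Polynomial.aeval_def, Polynomial.eval₂_eq_eval_map]
  have hcc : ∀ b, constantCoeff (Polynomial.aeval (X ^ r * b : ℂ⟦X⟧) k) = k.eval 0 := by
    intro b
    rw [Polynomial.aeval_def, Polynomial.hom_eval₂]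
    simp [hr.ne', Polynomial.eval₂_eq_eval_map]
  obtain ⟨b, hb, hby⟩ := hensel_ps (Polynomial.X ^ e - q) y
    (by
      simp only [Polynomial.eval_sub, Polynomial.eval_pow, Polynomial.eval_X,
        hqe, map_sub, map_pow, hcc, constantCoeff_C, hy, sub_self])
    (by
      have : constantCoeff (q.derivative.eval (PowerSeries.C y)) = 0 := by
        rw [hq, Polynomial.derivative_comp, Polynomial.derivative_C_mul, Polynomial.derivative_X,
          mul_one, Polynomial.eval_mul, Polynomial.eval_C, map_mul, map_pow, constantCoeff_X,
          zero_pow hr.ne', zero_mul]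
      simp only [Polynomial.derivative_sub, Polynomial.eval_sub,
        Polynomial.eval_mul, Polynomial.derivative_X_pow, Polynomial.eval_pow,
        Polynomial.eval_X, map_sub, map_mul, map_pow, constantCoeff_C, this,
        Polynomial.eval_C, sub_zero, Polynomial.eval_natCast, map_natCast]
      refine mul_ne_zero ?_ (pow_ne_zero _ hy0)
      exact_mod_cast he.ne')
  refine ⟨b, hby ▸ hy0, ?_⟩
  rw [← hqe]
  have := hb
  simp [sub_eq_zero] at this
  exact this.symm

end MV

namespace MV
open LaurentPolynomial

section ev
variable {S : Type*} [CommRing S] [Algebra ℂ S] (D : S →ₗ[ℂ] S) (ev : ℝ → S →ₐ[ℂ] ℂ)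

lemma ev_cont (hev : ∀ v x, HasDerivAt (fun x => ev x v) (ev x (D v)) x) (v : S) :
    Continuous (fun x => ev x v) :=
  continuous_iff_continuousAt.2 fun x => (hev v x).continuousAt

lemma ev_ftc (hev : ∀ v x, HasDerivAt (fun x => ev x v) (ev x (D v)) x) (v : S) (a b : ℝ) :
    ∫ x in a..b, ev x (D v) = ev b v - ev a v :=
  intervalIntegral.integral_eq_sub_of_hasDerivAt (fun x _ => hev v x)
    ((ev_cont D ev hev _).intervalIntegrable _ _)

lemma word_lemma (T : ℝ) (hT : 0 < T) (n : ℕ) (a : Fin n → ℝ → ℂ)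
    (hev : ∀ v x, HasDerivAt (fun x => ev x v) (ev x (D v)) x)
    (G : Fin n → S) (ha : ∀ i, ∀ x ∈ Icc (0:ℝ) T, a i x = ev x (D (G i)))
    (P : S → Prop) (h1 : P 1)
    (hP : ∀ F i, P F → ∃ F', P F' ∧ D F' = D (G i) * F ∧ ev 0 F' = 0 ∧ ev T F' = 0) :
    ∀ l : List (Fin n), l ≠ [] → iterInt T a l = 0 := by
  have key : ∀ l : List (Fin n), ∃ F, P F ∧ (∀ x ∈ Icc (0:ℝ) T, simplexInt (l.map a) x = ev x F) ∧
      (l ≠ [] → ev T F = 0) := by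
    intro l
    induction l with
    | nil => exact ⟨1, h1, fun x _ => by simp [simplexInt], by simp⟩
    | cons i l ih =>
      obtain ⟨F, hF, hFx, -⟩ := ih
      obtain ⟨F', hF', hD, h0, hTT⟩ := hP F i hF
      refine ⟨F', hF', ?_, fun _ => hTT⟩
      intro x hx
      have : simplexInt ((i :: l).map a) x = ∫ s in (0:ℝ)..x, a i s * simplexInt (l.map a) s := by
        simp [simplexInt]
      rw [this]
      have h2 : ∫ s in (0:ℝ)..x, a i s * simplexInt (l.map a) s = ∫ s in (0:ℝ)..x, ev s (D F') := by
        apply intervalIntegral.integral_congr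
        intro s hs
        rw [uIcc_of_le hx.1] at hs
        have hs' : s ∈ Icc (0:ℝ) T := ⟨hs.1, hs.2.trans hx.2⟩
        simp only [hD, map_mul, hFx s hs', ha i s hs']
      rw [h2, ev_ftc D ev hev, h0, sub_zero]
  intro l hl
  obtain ⟨F, -, hF, hF2⟩ := key l.reverse
  rw [iterInt, ← List.map_reverse, hF T ⟨hT.le, le_rfl⟩, hF2 (by simpa using hl)]

lemma moments_int (T : ℝ) (hT : 0 < T) (n : ℕ) (a : Fin n → ℝ → ℂ)
    (hev : ∀ v x, HasDerivAt (fun x => ev x v) (ev x (D v)) x)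
    (hD : ∀ v w, D (v * w) = D v * w + v * D w)
    (G : Fin n → S) (ha : ∀ i, ∀ x ∈ Icc (0:ℝ) T, a i x = ev x (D (G i)))
    (hG : ∀ i, ev 0 (G i) = 0)
    (hm : ∀ (ps : List (Fin n × ℕ)), (∀ q ∈ ps, 0 < q.2) →
      ∀ i : Fin n, moment T a ps i = 0) :
    ∀ r ∈ Algebra.adjoin ℂ (Set.range G), ∀ g ∈ Algebra.adjoin ℂ (Set.range G),
      ∫ x in (0:ℝ)..T, ev x (r * D g) = 0 := by
  have hprim : ∀ i, ∀ x ∈ Icc (0:ℝ) T, primitive (a i) x = ev x (G i) := by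
    intro i x hx
    rw [primitive]
    have h2 : ∫ s in (0:ℝ)..x, a i s = ∫ s in (0:ℝ)..x, ev s (D (G i)) := by
      apply intervalIntegral.integral_congr
      intro s hs
      rw [uIcc_of_le hx.1] at hs
      exact ha i s ⟨hs.1, hs.2.trans hx.2⟩
    rw [h2, ev_ftc D ev hev, hG, sub_zero]
  have hint : ∀ v : S, IntervalIntegrable (fun x => ev x v) volume 0 T := fun v =>
    (ev_cont D ev hev v).intervalIntegrable _ _
  have hlist : ∀ (l : List (Fin n)) (i : Fin n),
      ∫ x in (0:ℝ)..T, ev x ((l.map G).prod * D (G i)) = 0 := by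
    intro l i
    have := hm (l.map fun j => (j, 1)) (by simp) i
    rw [moment] at this
    rw [← this]
    apply intervalIntegral.integral_congr
    intro x hx
    rw [uIcc_of_le hT.le] at hx
    simp only [map_mul, List.map_map, map_list_prod, ha i x hx]
    congr 2
    refine List.map_congr_left fun j _ => ?_
    simp [hprim j x hx]
  have step1 : ∀ r ∈ Algebra.adjoin ℂ (Set.range G), ∀ i, ∫ x in (0:ℝ)..T, ev x (r * D (G i)) = 0 := by
    intro r hr i
    rw [← Subalgebra.mem_toSubmodule, Algebra.adjoin_eq_span] at hr
    induction hr using Submodule.span_induction with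
    | mem x hx =>
      obtain ⟨l, hl, rfl⟩ := Submonoid.exists_list_of_mem_closure hx
      have : ∃ l' : List (Fin n), l = l'.map G := by
        clear hx
        induction l with
        | nil => exact ⟨[], rfl⟩
        | cons y l ih =>
          obtain ⟨j, hj⟩ := hl y (by simp)
          obtain ⟨l', hl'⟩ := ih (fun z hz => hl z (by simp [hz]))
          exact ⟨j :: l', by simp [hj, hl']⟩
      obtain ⟨l', rfl⟩ := this
      exact hlist l' i
    | zero => simp
    | add x y _ _ hx hy =>
      simp only [add_mul, map_add]
      rw [intervalIntegral.integral_add (hint _) (hint _), hx, hy, add_zero]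
    | smul c x _ hx =>
      simp only [smul_mul_assoc, map_smul]
      rw [intervalIntegral.integral_smul, hx, smul_zero]
  have D1 : D 1 = 0 := by
    have := hD 1 1
    simpa using this
  intro r hr g hg
  induction hg using Algebra.adjoin_induction generalizing r with
  | mem x hx => obtain ⟨i, rfl⟩ := hx; exact step1 r hr i
  | algebraMap c => simp [Algebra.algebraMap_eq_smul_one, D1]
  | add x y _ _ hx hy =>
    simp only [mul_add, map_add]
    rw [intervalIntegral.integral_add (hint _) (hint _), hx r hr, hy r hr, add_zero]
  | mul x y hxR hyR hx hy =>
    have : r * D (x * y) = r * y * D x + r * x * D y := by rw [hD]; ring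
    rw [this]
    simp only [map_add]
    rw [intervalIntegral.integral_add (hint _) (hint _), hx _ (mul_mem hr hyR),
      hy _ (mul_mem hr hxR), add_zero]

end ev

section gen
variable {R : Type*} [CommRing R] [Algebra ℂ R] {Ω : Type*} [CommRing Ω] [Algebra ℂ Ω]

/-- hom out of Laurent polynomials -/
def lft (f : R →ₐ[ℂ] Ω) (x : Ωˣ) : R[T;T⁻¹] →ₐ[ℂ] Ω :=
  { eval₂ (f : R →+* Ω) x with
    commutes' := fun r => by
      have : algebraMap ℂ R[T;T⁻¹] r = C (algebraMap ℂ R r) := by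
        rfl
      simp [this] }

lemma lft_C (f : R →ₐ[ℂ] Ω) (x : Ωˣ) (p : R) : lft f x (C p) = f p := eval₂_C _ _ _
lemma lft_T (f : R →ₐ[ℂ] Ω) (x : Ωˣ) (j : ℤ) : lft f x (T j) = ((x ^ j : Ωˣ) : Ω) := eval₂_T _ _ _

/-- the unit `e^{c x}` -/
def expu (c : ℂ) (x : ℝ) : ℂˣ := Units.mk0 (Complex.exp (c * x)) (Complex.exp_ne_zero _)

lemma expu_zpow (c : ℂ) (x : ℝ) (j : ℤ) : ((expu c x ^ j : ℂˣ) : ℂ) = Complex.exp (c * j * x) := by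
  rw [Units.val_zpow_eq_zpow_val, expu, Units.val_mk0, ← Complex.exp_int_mul]
  congr 1; ring

lemma ev_der (δ : Derivation ℂ R R) (c : ℂ) (e : ℝ → R →ₐ[ℂ] ℂ)
    (he : ∀ p x, HasDerivAt (fun x => e x p) (e x (δ p)) x) (v : R[T;T⁻¹]) (x : ℝ) :
    HasDerivAt (fun x => lft (e x) (expu c x) v) (lft (e x) (expu c x) (D δ c v)) x := by
  induction v using LaurentPolynomial.induction_on' with
  | add p q hp hq => simp only [map_add]; exact hp.add hq
  | C_mul_T j p =>
    rw [D_CT]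
    simp only [map_mul, lft_C, lft_T, expu_zpow]
    have h2 : HasDerivAt (fun x : ℝ => Complex.exp (c * j * x)) (Complex.exp (c * j * x) * (c * j)) x := by
      have h3 : HasDerivAt (fun x : ℝ => c * j * (x : ℂ)) (c * j * 1) x :=
        (Complex.ofRealCLM.hasDerivAt (x := x)).const_mul (c * (j:ℂ))
      rw [mul_one] at h3
      exact h3.cexp
    refine ((he p x).mul h2).congr_deriv ?_
    rw [map_add, map_smul, smul_eq_mul]; ring

end gen
end MV

namespace MV
open LaurentPolynomial

/-- the big ring `ℂ[s][z,z⁻¹]` -/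
abbrev VV := LaurentPolynomial (Polynomial ℂ)

/-- derivation of `ℂ[s]` -/
abbrev dP : Derivation ℂ (Polynomial ℂ) (Polynomial ℂ) := Polynomial.derivative'

section poly
open Polynomial

lemma aeval_mem {M : Type*} [AddCommGroup M] [Module ℂ M] (Θ : Module.End ℂ M) (N : Submodule ℂ M)
    (h : ∀ v ∈ N, Θ v ∈ N) (q : ℂ[X]) : ∀ v ∈ N, aeval Θ q v ∈ N := by
  induction q using Polynomial.induction_on with
  | C a => intro v hv; simpa using N.smul_mem a hv
  | add p q hp hq => intro v hv; simpa using N.add_mem (hp v hv) (hq v hv)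
  | monomial n a ih =>
    intro v hv
    rw [pow_succ, ← mul_assoc, map_mul, aeval_X, Module.End.mul_apply]
    exact ih _ (h v hv)

lemma aeval_eigen {M : Type*} [AddCommGroup M] [Module ℂ M] (Θ : Module.End ℂ M) (N : Submodule ℂ M)
    (h : ∀ v ∈ N, Θ v ∈ N) (L : M →ₗ[ℂ] ℂ) (a : ℂ) (hL : ∀ v ∈ N, L (Θ v) = a * L v) (q : ℂ[X]) :
    ∀ v ∈ N, L (aeval Θ q v) = q.eval a * L v := by
  induction q using Polynomial.induction_on with
  | C a => intro v hv; simp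
  | add p q hp hq => intro v hv; simp [hp v hv, hq v hv, add_mul]
  | monomial n b ih =>
    intro v hv
    rw [pow_succ, ← mul_assoc, map_mul, aeval_X, Module.End.mul_apply, ih _ (h v hv), hL v hv,
      eval_mul_X, mul_assoc]

lemma dvd_of_roots (u w : ℂ[X]) (hu : u ≠ 0)
    (h : ∀ s, (X - Polynomial.C s) ^ (u.rootMultiplicity s) ∣ w) : u ∣ w := by
  by_cases hw : w = 0
  · rw [hw]; exact dvd_zero _
  have hs := IsAlgClosed.splits u
  rw [hs.eq_prod_roots]
  have hlc : u.leadingCoeff ≠ 0 := leadingCoeff_ne_zero.2 hu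
  refine (IsUnit.mul_left_dvd (Polynomial.isUnit_C.2 (isUnit_iff_ne_zero.2 hlc))).2 ?_
  rw [Multiset.prod_X_sub_C_dvd_iff_le_roots hw, Multiset.le_iff_count]
  intro a
  rw [count_roots, count_roots, le_rootMultiplicity_iff hw]
  exact h a

lemma exists_eta (u : ℂ[X]) (hu : 0 < u.natDegree) :
    ∃ η Δ : ℂ[X], u * Δ.comp u = η * derivative u ∧ Δ.eval 0 = 1 := by
  classical
  have hu' : derivative u ≠ 0 := by
    intro h
    have := derivative_eq_zero.1 h
    omega
  have hu0 : u ≠ 0 := by rintro rfl; simp at hu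
  set v := derivative u with hv
  set A := v.roots.filter (fun ρ => u.eval ρ = 0) with hA
  set B := v.roots.filter (fun ρ => ¬ u.eval ρ = 0) with hB
  have h1 : (A.map fun a => X - Polynomial.C a).prod ∣ u := by
    rw [Multiset.prod_X_sub_C_dvd_iff_le_roots hu0, Multiset.le_iff_count]
    intro a
    rw [hA, Multiset.count_filter, count_roots, count_roots]
    split_ifs with h
    · have := derivative_rootMultiplicity_of_root (p := u) (t := a) h
      rw [hv, this]; omega
    · exact Nat.zero_le _
  set Δ0 := (B.map fun a => X - Polynomial.C (u.eval a)).prod with hΔ0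
  have h2 : (B.map fun a => X - Polynomial.C a).prod ∣ Δ0.comp u := by
    rw [hΔ0]
    clear_value B
    clear hΔ0 Δ0 hB
    induction B using Multiset.induction with
    | empty => simp
    | cons a s ih =>
      simp only [Multiset.map_cons, Multiset.prod_cons, mul_comp]
      refine mul_dvd_mul ?_ ih
      simp only [sub_comp, X_comp, C_comp]
      rw [dvd_iff_isRoot]; simp
  have h3 : Δ0.eval 0 ≠ 0 := by
    rw [hΔ0, eval_multiset_prod]
    apply Multiset.prod_ne_zero
    simp only [Multiset.map_map, Function.comp, eval_sub, eval_X, eval_C, Multiset.mem_map, not_exists, not_and]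
    intro a ha h
    rw [hB, Multiset.mem_filter] at ha
    apply ha.2
    simpa using h
  have h4 : v ∣ u * Δ0.comp u := by
    have hs := IsAlgClosed.splits v
    rw [hs.eq_prod_roots]
    have hlc : v.leadingCoeff ≠ 0 := leadingCoeff_ne_zero.2 hu'
    refine (IsUnit.mul_left_dvd (Polynomial.isUnit_C.2 (isUnit_iff_ne_zero.2 hlc))).2 ?_
    rw [← Multiset.filter_add_not (fun ρ => u.eval ρ = 0) v.roots, Multiset.map_add, Multiset.prod_add]
    exact mul_dvd_mul h1 h2
  obtain ⟨η, hη⟩ := h4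
  refine ⟨Polynomial.C (Δ0.eval 0)⁻¹ * η, Polynomial.C (Δ0.eval 0)⁻¹ * Δ0, ?_, ?_⟩
  · rw [mul_comp, C_comp]; linear_combination (Polynomial.C (Δ0.eval 0)⁻¹) * hη
  · simp [h3]

lemma eta_local (u η Δ : ℂ[X]) (h : u * Δ.comp u = η * derivative u) (hΔ : Δ.eval 0 = 1)
    (hu : u ≠ 0) (s : ℂ) (hs : u.eval s = 0) :
    ∃ η1, η = (X - Polynomial.C s) * η1 ∧ η1.eval s = (u.rootMultiplicity s : ℂ)⁻¹ := by
  set e := u.rootMultiplicity s with he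
  have he0 : 0 < e := by rw [he, rootMultiplicity_pos hu]; exact hs
  obtain ⟨k, hk, hks⟩ := exists_eq_pow_rootMultiplicity_mul_and_not_dvd u hu s
  rw [← he] at hk
  have hks' : k.eval s ≠ 0 := by
    intro h; exact hks (dvd_iff_isRoot.2 h)
  clear_value e
  obtain ⟨e', rfl⟩ : ∃ e', e = e' + 1 := ⟨e - 1, by omega⟩
  have hd : derivative u = (X - Polynomial.C s) ^ e' * ((e' + 1 : ℂ[X]) * k + (X - Polynomial.C s) * derivative k) := by
    rw [hk]
    simp only [derivative_mul, derivative_pow, derivative_sub, derivative_X, derivative_C]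
    simp; ring
  have hX : (X - Polynomial.C s) ^ e' ≠ 0 := pow_ne_zero _ (X_sub_C_ne_zero s)
  have h1 : (X - Polynomial.C s) * (k * Δ.comp u) = η * ((e' + 1 : ℂ[X]) * k + (X - Polynomial.C s) * derivative k) := by
    apply mul_left_cancel₀ hX
    rw [hd] at h
    have : u * Δ.comp u = (X - Polynomial.C s) ^ (e' + 1) * k * Δ.comp u := by rw [← hk]
    rw [this] at h
    linear_combination h
  have he1 : (e' : ℂ) + 1 ≠ 0 := by exact_mod_cast he0.ne'
  have h2 : η.eval s = 0 := by
    have := congrArg (eval s) h1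
    simp at this
    rcases this with h | h | h
    · exact h
    · exact absurd h he1
    · exact absurd h hks'
  obtain ⟨η1, rfl⟩ := dvd_iff_isRoot.2 h2
  refine ⟨η1, rfl, ?_⟩
  have h3 : k * Δ.comp u = η1 * ((e' + 1 : ℂ[X]) * k + (X - Polynomial.C s) * derivative k) := by
    apply mul_left_cancel₀ (X_sub_C_ne_zero s)
    linear_combination h1
  have := congrArg (eval s) h3
  simp [eval_comp, hs, hΔ] at this
  push_cast
  field_simp
  have h5 : k.eval s * (η1.eval s * (e' + 1) - 1) = 0 := by linear_combination -this
  rcases mul_eq_zero.1 h5 with h | h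
  · exact absurd h hks'
  · linear_combination h

/-- the auxiliary polynomial `p` -/
def pp (N : ℕ) : ℂ[X] := ∏ e ∈ Finset.range (N + 1), ∏ i ∈ Finset.Ico 1 e, (X - Polynomial.C ((i : ℂ) / e))

lemma pp_int (N : ℕ) (a : ℤ) : (pp N).eval (a : ℂ) ≠ 0 := by
  rw [pp, eval_prod, Finset.prod_ne_zero_iff]
  intro e he
  rw [eval_prod, Finset.prod_ne_zero_iff]
  intro i hi
  rw [Finset.mem_Ico] at hi
  simp only [eval_sub, eval_X, eval_C]
  intro h
  have he0 : (e : ℂ) ≠ 0 := by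
    have : e ≠ 0 := by omega
    exact_mod_cast this
  have h1 : (a : ℂ) * e = i := by
    field_simp at h; linear_combination h
  have h2 : a * e = i := by exact_mod_cast h1
  have h3 : 0 < a * (e : ℤ) := by rw [h2]; exact_mod_cast hi.1
  have h4 : 0 < a := by
    by_contra hh
    push Not at hh
    nlinarith [hi.1]
  have h5 : a * (e : ℤ) < e := by rw [h2]; exact_mod_cast hi.2
  nlinarith

lemma pp_dvd (N e : ℕ) (he : 0 < e) (heN : e ≤ N) :
    (∏ i ∈ Finset.range e, (X - Polynomial.C ((i : ℂ) / e))) ∣ X * pp N := by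
  rw [Finset.range_eq_Ico, Finset.prod_eq_prod_Ico_succ_bot he]
  simp only [Nat.cast_zero, zero_div, map_zero, sub_zero, zero_add]
  exact mul_dvd_mul_left _ (Finset.dvd_prod_of_mem
    (fun e : ℕ => ∏ i ∈ Finset.Ico 1 e, (X - Polynomial.C ((i : ℂ) / e)))
    (Finset.mem_range.2 (by omega : e < N + 1)))

/-- coefficientwise `Θ` -/
def EE (η : ℂ[X]) (b : ℂ) : ℂ[X] →ₗ[ℂ] ℂ[X] where
  toFun p := η * (derivative p + b • p)
  map_add' p q := by simp; ring
  map_smul' a p := by simp [Polynomial.smul_eq_C_mul]; ring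

lemma EE_step (η η1 : ℂ[X]) (b s : ℂ) (hη : η = (X - Polynomial.C s) * η1) (e : ℕ)
    (hs : η1.eval s = (e : ℂ)⁻¹) (i : ℕ) (p : ℂ[X]) (hp : (X - Polynomial.C s) ^ i ∣ p) :
    (X - Polynomial.C s) ^ (i + 1) ∣ (aeval (EE η b) (X - Polynomial.C ((i : ℂ) / e))) p := by
  obtain ⟨q, rfl⟩ := hp
  have hr : (X - Polynomial.C s) ∣ (η1 - Polynomial.C ((e : ℂ)⁻¹)) := by
    rw [dvd_iff_isRoot]; simp [hs]
  obtain ⟨w, hw⟩ := hr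
  have hw' : η1 = (X - Polynomial.C s) * w + Polynomial.C ((e : ℂ)⁻¹) := by rw [← hw]; ring
  simp only [map_sub, aeval_X, aeval_C, LinearMap.sub_apply, Module.algebraMap_end_apply]
  have hE : EE η b ((X - Polynomial.C s) ^ i * q) = (X - Polynomial.C s) ^ i * ((i : ℂ[X]) * η1 * q + (X - Polynomial.C s) * (η1 * (derivative q + b • q))) := by
    simp only [EE, LinearMap.coe_mk, AddHom.coe_mk, derivative_mul, derivative_pow, hη]
    rcases i with _ | i
    · simp [Polynomial.smul_eq_C_mul]; ring
    · simp [Polynomial.smul_eq_C_mul]; ring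
  refine ⟨(i : ℂ[X]) * w * q + η1 * (derivative q + b • q), ?_⟩
  rw [hE, Polynomial.smul_eq_C_mul ((i : ℂ) / e), div_eq_mul_inv, map_mul Polynomial.C,
    map_natCast]
  linear_combination (X - Polynomial.C s) ^ i * (i : ℂ[X]) * q * hw'

lemma EE_dvd (u η Δ : ℂ[X]) (h : u * Δ.comp u = η * derivative u) (hΔ : Δ.eval 0 = 1)
    (hu : u ≠ 0) (b : ℂ) (p : ℂ[X]) :
    u ∣ (aeval (EE η b) (X * pp u.natDegree)) p := by
  apply dvd_of_roots _ _ hu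
  intro s
  set e := u.rootMultiplicity s with he
  rcases Nat.eq_zero_or_pos e with h0 | h0
  · rw [h0]; simp
  have hs : u.eval s = 0 := (rootMultiplicity_pos hu).1 h0
  obtain ⟨η1, hη, hη1⟩ := eta_local u η Δ h hΔ hu s hs
  have heN : e ≤ u.natDegree := by
    rw [he, ← count_roots]
    exact (Multiset.count_le_card _ _).trans (card_roots' u)
  obtain ⟨r, hr⟩ := pp_dvd _ e h0 heN
  rw [hr, mul_comm, map_mul, Module.End.mul_apply]
  have key : ∀ k, k ≤ e → ∀ p, (X - Polynomial.C s) ^ k ∣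
      (aeval (EE η b) (∏ i ∈ Finset.range k, (X - Polynomial.C ((i : ℂ) / e)))) p := by
    intro k hk
    induction k with
    | zero => intro p; simp
    | succ k ih =>
      intro p
      rw [Finset.prod_range_succ, mul_comm, map_mul, Module.End.mul_apply]
      exact EE_step η η1 b s hη e hη1 k _ (ih (by omega) p)
  have key2 := key e le_rfl p
  generalize (aeval (EE η b) (∏ i ∈ Finset.range e, (X - Polynomial.C ((i : ℂ) / e)))) p = q at key2
  -- E preserves divisibility
  have hstab : ∀ q, (X - Polynomial.C s) ^ e ∣ q → (X - Polynomial.C s) ^ e ∣ EE η b q := by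
    rintro _ ⟨q, rfl⟩
    obtain ⟨e', he'⟩ : ∃ e', e = e' + 1 := ⟨e - 1, by omega⟩
    simp only [EE, LinearMap.coe_mk, AddHom.coe_mk, hη, he']
    refine ⟨η1 * ((e' + 1 : ℂ[X]) * q + (X - Polynomial.C s) * (derivative q + b • q)), ?_⟩
    simp [derivative_mul, derivative_pow, Polynomial.smul_eq_C_mul]; ring
  let N : Submodule ℂ ℂ[X] :=
    { carrier := {q | (X - Polynomial.C s) ^ e ∣ q}
      add_mem' := fun h1 h2 => dvd_add h1 h2
      zero_mem' := dvd_zero _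
      smul_mem' := fun c q h => by
        rw [Set.mem_ofPred_eq, Polynomial.smul_eq_C_mul]; exact dvd_mul_of_dvd_right h _ }
  exact aeval_mem _ N (fun v hv => hstab v hv) r q key2

end poly
end MV

namespace MV
open LaurentPolynomial

lemma coeff_C_mul' (p : Polynomial ℂ) (v : VV) (j : ℤ) : (C p * v).coeff j = p * v.coeff j := by
  rw [← LaurentPolynomial.smul_eq_C_mul]
  simp

/-- `Θ = η D` -/
def Th (c : ℂ) (η : Polynomial ℂ) : Module.End ℂ VV := (LinearMap.mulLeft ℂ (C η)) ∘ₗ D dP c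

lemma Th_apply (c : ℂ) (η : Polynomial ℂ) (v : VV) : Th c η v = C η * D dP c v := rfl

lemma coeff_Th (c : ℂ) (η : Polynomial ℂ) (v : VV) (j : ℤ) :
    (Th c η v).coeff j = EE η (c * j) (v.coeff j) := by
  rw [Th_apply, coeff_C_mul', coeff_D]; rfl

lemma coeff_aeval_Th (c : ℂ) (η : Polynomial ℂ) (q : Polynomial ℂ) (j : ℤ) : ∀ v : VV,
    (Polynomial.aeval (Th c η) q v).coeff j = Polynomial.aeval (EE η (c * j)) q (v.coeff j) := by
  induction q using Polynomial.induction_on with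
  | C a => intro v; simp
  | add p q hp hq => intro v; simp [hp v, hq v]
  | monomial n a ih =>
    intro v
    rw [pow_succ, ← mul_assoc, map_mul, Polynomial.aeval_X, Module.End.mul_apply, ih, coeff_Th,
      map_mul (Polynomial.aeval (EE η (c * j))) _ Polynomial.X, Polynomial.aeval_X, Module.End.mul_apply]

lemma coeff_sum_CT (J : Finset ℤ) (f : ℤ → Polynomial ℂ) (k : ℤ) :
    (∑ j ∈ J, C (f j) * T j : VV).coeff k = if k ∈ J then f k else 0 := by
  rw [AddMonoidAlgebra.coeff_sum, Finset.sum_apply']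
  simp only [coeff_CT]
  rw [Finset.sum_ite_eq' J k f]

lemma eq_sum_CT (v : VV) (J : Finset ℤ) (h : v.coeff.support ⊆ J) : v = ∑ j ∈ J, C (v.coeff j) * T j := by
  apply LaurentPolynomial.ext
  intro k
  rw [coeff_sum_CT J (fun j => v.coeff j)]
  split_ifs with hk
  · rfl
  · by_contra h'
    exact hk (h (Finsupp.mem_support_iff.2 h'))

lemma chi_div (c : ℂ) (u η Δ : Polynomial ℂ) (h : u * Δ.comp u = η * Polynomial.derivative u)
    (hΔ : Δ.eval 0 = 1) (hu : u ≠ 0) (v : VV) :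
    ∃ v1 : VV, Polynomial.aeval (Th c η) (Polynomial.X * pp u.natDegree) v = C u * v1 := by
  have := fun j : ℤ => EE_dvd u η Δ h hΔ hu (c * j) (v.coeff j)
  choose q hq using this
  refine ⟨∑ j ∈ v.coeff.support, C (q j) * T j, ?_⟩
  apply LaurentPolynomial.ext
  intro k
  rw [coeff_aeval_Th, coeff_C_mul', coeff_sum_CT]
  split_ifs with hk
  · exact hq k
  · rw [Finsupp.notMem_support_iff] at hk
    rw [hk]; simp

section A
variable (c : ℂ) (u η Δ : Polynomial ℂ) (h : u * Δ.comp u = η * Polynomial.derivative u)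
    (hΔ : Δ.eval 0 = 1) (hu : 0 < u.natDegree) (I : VV →ₗ[ℂ] ℂ) (e0 e1 : VV →ₐ[ℂ] ℂ)
    (hI : ∀ v, I (D dP c v) = e1 v - e0 v) (hu0 : e0 (C u) = 0) (hu1 : e1 (C u) = 0)

/-- `Λ_v(F)` -/
def Lam (F : Polynomial ℂ) : VV →ₗ[ℂ] ℂ :=
  I ∘ₗ LinearMap.mulLeft ℂ (C (F.comp u * Polynomial.derivative u))

lemma Lam_apply (F : Polynomial ℂ) (v : VV) :
    Lam u I F v = I (C (F.comp u * Polynomial.derivative u) * v) := rfl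

lemma Lam_add (F G : Polynomial ℂ) (v : VV) : Lam u I (F + G) v = Lam u I F v + Lam u I G v := by
  simp only [Lam_apply, Polynomial.add_comp, add_mul, map_add]

lemma Lam_smul (a : ℂ) (F : Polynomial ℂ) (v : VV) :
    Lam u I (Polynomial.C a * F) v = a * Lam u I F v := by
  rw [Lam_apply, Lam_apply, Polynomial.mul_comp, Polynomial.C_comp, mul_assoc, ← Polynomial.smul_eq_C_mul]
  have : (C (a • (F.comp u * Polynomial.derivative u)) : VV) = a • C (F.comp u * Polynomial.derivative u) := by
    have := smul_CT a (F.comp u * Polynomial.derivative u) 0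
    simpa using this.symm
  rw [this, smul_mul_assoc, map_smul, smul_eq_mul]

lemma Lam_mul (F q : Polynomial ℂ) (v : VV) :
    Lam u I F (C (q.comp u) * v) = Lam u I (q * F) v := by
  have e : F.comp u * Polynomial.derivative u * q.comp u = q.comp u * F.comp u * Polynomial.derivative u := by ring
  rw [Lam_apply, Lam_apply, Polynomial.mul_comp, ← mul_assoc, ← map_mul, e]

lemma Lam_u (F : Polynomial ℂ) (v : VV) :
    Lam u I F (C u * v) = Lam u I (Polynomial.X * F) v := by
  have := Lam_mul u I F Polynomial.X v
  simpa using this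

lemma e_comp (e : VV →ₐ[ℂ] ℂ) (he : e (C u) = 0) (H : Polynomial ℂ) : e (C (H.comp u)) = H.eval 0 := by
  induction H using Polynomial.induction_on' with
  | add p q hp hq => simp [Polynomial.add_comp, hp, hq]
  | monomial n a =>
    rw [← Polynomial.C_mul_X_pow_eq_monomial]
    simp only [Polynomial.mul_comp, Polynomial.C_comp, Polynomial.X_pow_comp, map_mul, map_pow, he,
      Polynomial.eval_mul, Polynomial.eval_C, Polynomial.eval_pow, Polynomial.eval_X]
    congr 1
    have : (C (Polynomial.C a) : VV) = algebraMap ℂ VV a := rfl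
    rw [this, AlgHom.commutes]; rfl

include hI hu0 hu1 in
lemma parts (H : Polynomial ℂ) (v : VV) : I (C (H.comp u) * D dP c v) =
    H.eval 0 * (e1 v - e0 v) - Lam u I (Polynomial.derivative H) v := by
  have h1 := hI (C (H.comp u) * v)
  rw [D_mul, D_C, map_mul, map_mul, e_comp u e0 hu0, e_comp u e1 hu1, map_add] at h1
  have h2 : (dP (H.comp u)) = (Polynomial.derivative H).comp u * Polynomial.derivative u := by
    show Polynomial.derivative (H.comp u) = _
    rw [Polynomial.derivative_comp]; ring
  rw [h2, ← Lam_apply] at h1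
  linear_combination h1

include h hI hu0 hu1 in
lemma Lam_Th (F : Polynomial ℂ) (v : VV) : Lam u I F (Th c η v) =
    - Lam u I (Polynomial.derivative (F * Polynomial.X * Δ)) v := by
  have h1 := parts c u I e0 e1 hI hu0 hu1 (F * Polynomial.X * Δ) v
  have h0 : Polynomial.eval 0 (F * Polynomial.X * Δ) = 0 := by simp
  rw [h0, zero_mul, zero_sub] at h1
  have e : F.comp u * Polynomial.derivative u * η = (F * Polynomial.X * Δ).comp u := by
    simp only [Polynomial.mul_comp, Polynomial.X_comp]
    linear_combination (- F.comp u) * h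
  rw [← h1, Lam_apply, Th_apply, ← mul_assoc, ← map_mul, e]

/-- `U_m` -/
def UU (m : ℕ) : Submodule ℂ VV :=
  ⨅ F : Polynomial ℂ, LinearMap.ker (Lam u I (Polynomial.X ^ m * F))

lemma mem_UU (m : ℕ) (v : VV) : v ∈ UU u I m ↔ ∀ F, Lam u I (Polynomial.X ^ m * F) v = 0 := by
  simp [UU, Submodule.mem_iInf]

lemma UU_mono (m : ℕ) (v : VV) (hv : v ∈ UU u I m) : v ∈ UU u I (m + 1) := by
  rw [mem_UU] at *
  intro F
  rw [pow_succ, mul_assoc]; exact hv _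

include h hI hu0 hu1 in
lemma UU_Th (m : ℕ) (v : VV) (hv : v ∈ UU u I m) : Th c η v ∈ UU u I m := by
  rw [mem_UU] at *
  intro F
  rw [Lam_Th c u η Δ h I e0 e1 hI hu0 hu1]
  have : Polynomial.derivative (Polynomial.X ^ m * F * Polynomial.X * Δ) = Polynomial.X ^ m *
    ((m + 1 : Polynomial ℂ) * F * Δ + Polynomial.X * Polynomial.derivative (F * Δ)) := by
    have e : Polynomial.X ^ m * F * Polynomial.X * Δ = Polynomial.X ^ (m + 1) * (F * Δ) := by ring
    rw [e, Polynomial.derivative_mul, Polynomial.derivative_X_pow]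
    simp; ring
  rw [this, hv, neg_zero]

include h hI hu0 hu1 hΔ in
lemma Lam_eigen (m : ℕ) (v : VV) (hv : v ∈ UU u I (m + 1)) :
    Lam u I (Polynomial.X ^ m) (Th c η v) = (-(m + 1 : ℂ)) * Lam u I (Polynomial.X ^ m) v := by
  rw [mem_UU] at hv
  rw [Lam_Th c u η Δ h I e0 e1 hI hu0 hu1]
  obtain ⟨Δ', hΔ'⟩ : Polynomial.X ∣ Δ - 1 := by
    rw [← sub_zero Polynomial.X, ← map_zero Polynomial.C, Polynomial.dvd_iff_isRoot]; simp [hΔ]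
  have hΔ2 : Δ = 1 + Polynomial.X * Δ' := by rw [← hΔ']; ring
  have : Polynomial.derivative (Polynomial.X ^ m * Polynomial.X * Δ) =
    Polynomial.C (m + 1 : ℂ) * Polynomial.X ^ m +
      Polynomial.X ^ (m + 1) * ((m + 1 : Polynomial ℂ) * Δ' + Polynomial.derivative Δ) := by
    rw [← pow_succ, Polynomial.derivative_mul, Polynomial.derivative_X_pow]
    simp
    linear_combination (m + 1 : Polynomial ℂ) * Polynomial.X ^ m * hΔ2
  rw [this, Lam_add, Lam_smul, hv]; ring

include h hI hu0 hu1 hΔ hu in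
lemma UU_step (m : ℕ) (v : VV) (hv : v ∈ UU u I (m + 1))
    (hst : ∀ v1 : VV, v1.coeff.support ⊆ v.coeff.support → v1 ∈ UU u I (m + 2) → v1 ∈ UU u I (m + 1)) :
    v ∈ UU u I m := by
  have hu0' : u ≠ 0 := by rintro rfl; simp at hu
  obtain ⟨v1, hv1⟩ := chi_div c u η Δ h hΔ hu0' v
  set χ := Polynomial.X * pp u.natDegree with hχ
  have hw := aeval_mem (Th c η) (UU u I (m + 1)) (UU_Th c u η Δ h I e0 e1 hI hu0 hu1 (m + 1)) χ v hv
  rw [hv1] at hw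
  have h1 : v1 ∈ UU u I (m + 2) := by
    rw [mem_UU] at hw ⊢
    intro F
    have := hw F
    rw [Lam_u] at this
    rw [← this]; congr 2; ring
  have hsupp : v1.coeff.support ⊆ v.coeff.support := by
    intro k hk
    rw [Finsupp.mem_support_iff] at *
    intro h0
    have e := congrArg (fun w : VV => w.coeff k) hv1
    simp only [coeff_aeval_Th, coeff_C_mul', h0, map_zero] at e
    exact hk ((mul_eq_zero.1 e.symm).resolve_left hu0')
  have h2 := hst v1 hsupp h1
  have h3 := aeval_eigen (Th c η) (UU u I (m + 1)) (UU_Th c u η Δ h I e0 e1 hI hu0 hu1 (m + 1))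
    (Lam u I (Polynomial.X ^ m)) (-(m + 1 : ℂ)) (Lam_eigen c u η Δ h hΔ I e0 e1 hI hu0 hu1 m) χ v hv
  rw [hv1, Lam_u] at h3
  have h4 : Lam u I (Polynomial.X * Polynomial.X ^ m) v1 = 0 := by
    rw [mem_UU] at h2
    have := h2 1
    rw [← this]; congr 2; ring
  rw [h4] at h3
  have h5 : χ.eval (-(m + 1 : ℂ)) ≠ 0 := by
    rw [hχ, Polynomial.eval_mul, Polynomial.eval_X]
    have : (-(m + 1 : ℂ)) = ((-(m + 1) : ℤ) : ℂ) := by push_cast; ring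
    refine mul_ne_zero (neg_ne_zero.2 (by exact_mod_cast Nat.succ_ne_zero m)) ?_
    rw [this]; exact pp_int _ _
  have h6 : Lam u I (Polynomial.X ^ m) v = 0 := (mul_eq_zero.1 h3.symm).resolve_left h5
  rw [mem_UU] at hv ⊢
  intro F
  have hF := Polynomial.divX_mul_X_add F
  rw [← hF, mul_add, Lam_add, mul_comm (Polynomial.X ^ m) (Polynomial.C _), Lam_smul, h6, mul_zero, add_zero]
  rw [← hv F.divX]; congr 2; ring

end A
end MV

namespace MV
open LaurentPolynomial

section fin
open Polynomial
/-- the algebra generated by `u` -/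
abbrev AA (u : ℂ[X]) : Subalgebra ℂ ℂ[X] := Algebra.adjoin ℂ {u}

lemma AA_noeth (u : ℂ[X]) : IsNoetherianRing (AA u) :=
  isNoetherianRing_of_fg (Subalgebra.fg_def.2 ⟨{u}, Set.finite_singleton u, rfl⟩)

lemma AA_fin (u : ℂ[X]) (hu : 0 < u.natDegree) : Module.Finite (AA u) ℂ[X] := by
  have hu0 : u ≠ 0 := by rintro rfl; simp at hu
  have hmem : u ∈ AA u := Algebra.subset_adjoin rfl
  have hint : IsIntegral (AA u) (X : ℂ[X]) := by
    set w := u * Polynomial.C (u.leadingCoeff⁻¹) with hw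
    have hmon : w.Monic := monic_mul_leadingCoeff_inv hu0
    have hwm : w ∈ AA u := by
      rw [hw, mul_comm, ← Polynomial.smul_eq_C_mul]
      exact Subalgebra.smul_mem _ hmem _
    have hdeg : 0 < w.natDegree := by
      rw [hw, natDegree_mul_C (inv_ne_zero (leadingCoeff_ne_zero.2 hu0))]; exact hu
    refine ⟨w.map (algebraMap ℂ (AA u)) - Polynomial.C ⟨w, hwm⟩, ?_, ?_⟩
    · apply Monic.sub_of_left (hmon.map _)
      refine lt_of_le_of_lt degree_C_le ?_
      rw [Monic.degree_map hmon]
      exact natDegree_pos_iff_degree_pos.1 hdeg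
    · rw [Polynomial.eval₂_sub, Polynomial.eval₂_C, eval₂_map, ← IsScalarTower.algebraMap_eq]
      show eval₂ Polynomial.C X w - w = 0
      rw [eval₂_C_X, sub_self]
  have h2 := hint.fg_adjoin_singleton
  have h3 : Algebra.adjoin (AA u) {(X : ℂ[X])} = ⊤ := by
    rw [eq_top_iff]
    intro p _
    induction p using Polynomial.induction_on with
    | C a => exact Subalgebra.algebraMap_mem _ (algebraMap ℂ (AA u) a)
    | add p q hp hq => exact Subalgebra.add_mem _ (hp trivial) (hq trivial)
    | monomial n a ih =>
      rw [pow_succ, ← mul_assoc]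
      exact Subalgebra.mul_mem _ (ih trivial) (Algebra.subset_adjoin rfl)
  rw [h3] at h2
  exact ⟨by simpa using h2⟩

end fin

section A
variable (c : ℂ) (u η Δ : Polynomial ℂ) (h : u * Δ.comp u = η * Polynomial.derivative u)
    (hΔ : Δ.eval 0 = 1) (hu : 0 < u.natDegree) (I : VV →ₗ[ℂ] ℂ) (e0 e1 : VV →ₐ[ℂ] ℂ)
    (hI : ∀ v, I (D dP c v) = e1 v - e0 v) (hu0 : e0 (C u) = 0) (hu1 : e1 (C u) = 0)

lemma UU_mul (m : ℕ) (v : VV) (hv : v ∈ UU u I m) (q : Polynomial ℂ) :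
    C (q.comp u) * v ∈ UU u I m := by
  rw [mem_UU] at *
  intro F
  have e : q * (Polynomial.X ^ m * F) = Polynomial.X ^ m * (q * F) := by ring
  rw [Lam_mul, e, hv]

/-- finite free version of `U_m` -/
def UJ (J : Finset ℤ) (m : ℕ) : Submodule (AA u) (J → Polynomial ℂ) where
  carrier := {f | ∑ j : J, (C (f j) * T j : VV) ∈ UU u I m}
  add_mem' {f g} hf hg := by
    have := (UU u I m).add_mem hf hg
    rw [← Finset.sum_add_distrib] at this
    simpa [add_mul] using this
  zero_mem' := by simp
  smul_mem' a f hf := by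
    obtain ⟨a, ha⟩ := a
    have ha' := ha
    rw [AA, Algebra.adjoin_singleton_eq_range_aeval] at ha'
    obtain ⟨q, hq⟩ := ha'
    have h1 := UU_mul u I m _ hf q
    have h2 : q.comp u = a := by rw [← hq]; rfl
    rw [h2, Finset.mul_sum] at h1
    show (∑ j : J, (C (a * f j) * T j : VV)) ∈ UU u I m
    simpa [mul_assoc] using h1

include hu in
lemma stab (J : Finset ℤ) : ∃ M, ∀ m ≥ M, ∀ v : VV, v.coeff.support ⊆ J → v ∈ UU u I (m + 1) → v ∈ UU u I m := by
  have := AA_noeth u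
  have := AA_fin u hu
  have hmono : Monotone (UJ u I J) := monotone_nat_of_le_succ fun m f hf => UU_mono u I m _ hf
  obtain ⟨M, hM⟩ := monotone_stabilizes_iff_noetherian.2
    (inferInstance : IsNoetherian (AA u) (J → Polynomial ℂ)) ⟨UJ u I J, hmono⟩
  refine ⟨M, fun m hm v hv hvm => ?_⟩
  have e : ∑ j : J, (C (v.coeff j) * T j : VV) = v := by
    rw [Finset.sum_coe_sort J (fun j => (C (v.coeff j) * T j : VV))]
    exact (eq_sum_CT v J hv).symm
  have h1 : (fun j : J => v.coeff j) ∈ UJ u I J (m + 1) := by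
    show ∑ j : J, (C (v.coeff j) * T j : VV) ∈ UU u I (m + 1)
    rw [e]; exact hvm
  have h2 : UJ u I J m = UJ u I J (m + 1) := (hM m hm).symm.trans (hM (m + 1) (by omega))
  rw [← h2] at h1
  have h3 : ∑ j : J, (C (v.coeff j) * T j : VV) ∈ UU u I m := h1
  rwa [e] at h3

include h hI hu0 hu1 hΔ hu in
lemma descend (J : Finset ℤ) (m : ℕ) (v : VV) (hv : v.coeff.support ⊆ J) (hvm : v ∈ UU u I (m + 1)) :
    v ∈ UU u I m := by
  obtain ⟨M, hM⟩ := stab u hu I J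
  have : ∀ d m : ℕ, M ≤ m + d → ∀ v : VV, v.coeff.support ⊆ J → v ∈ UU u I (m + 1) → v ∈ UU u I m := by
    intro d
    induction d with
    | zero => intro m hm; exact hM m hm
    | succ d ih =>
      intro m hm v hv hvm
      exact UU_step c u η Δ h hΔ hu I e0 e1 hI hu0 hu1 m v hvm
        fun v1 h1 h2 => ih (m + 1) (by omega) v1 (h1.trans hv) h2
  exact this M m (by omega) v hv hvm

include h hI hu0 hu1 hΔ hu in
lemma mainA1 (v : VV) (hv : C u * v ∈ UU u I 0) : v ∈ UU u I 0 := by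
  refine descend c u η Δ h hΔ hu I e0 e1 hI hu0 hu1 v.coeff.support 0 v le_rfl ?_
  rw [mem_UU] at *
  intro F
  have := hv F
  rw [Lam_u] at this
  rw [← this]; congr 2; ring

include h hI hu0 hu1 hΔ hu in
lemma mainA3 (v : VV) (hv : v ∈ UU u I 0) : ∃ v1 ∈ UU u I 0,
    Polynomial.aeval (Th c η) (Polynomial.X * pp u.natDegree) v = C u * v1 := by
  have hu0' : u ≠ 0 := by rintro rfl; simp at hu
  obtain ⟨v1, hv1⟩ := chi_div c u η Δ h hΔ hu0' v
  refine ⟨v1, ?_, hv1⟩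
  apply mainA1 c u η Δ h hΔ hu I e0 e1 hI hu0 hu1
  rw [← hv1]
  exact aeval_mem _ _ (UU_Th c u η Δ h I e0 e1 hI hu0 hu1 0) _ v hv

include h hI hu0 hu1 hΔ hu in
lemma mainA2 (he0 : e0 (C η) = 0) (he1 : e1 (C η) = 0) (v : VV) (hv : v ∈ UU u I 0) : e1 v = e0 v := by
  have hu0' : u ≠ 0 := by rintro rfl; simp at hu
  obtain ⟨v1, hv1, hv1'⟩ := mainA3 c u η Δ h hΔ hu I e0 e1 hI hu0 hu1 v hv
  set y := Polynomial.aeval (Th c η) (pp u.natDegree) v with hy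
  have hyU : y ∈ UU u I 0 := aeval_mem _ _ (UU_Th c u η Δ h I e0 e1 hI hu0 hu1 0) _ v hv
  rw [map_mul, Polynomial.aeval_X, Module.End.mul_apply, ← hy, Th_apply] at hv1'
  have key : C (Δ.comp u) * D dP c y = C (Polynomial.derivative u) * v1 := by
    have hC : (C u : VV) ≠ 0 := by
      intro h0
      have := congrArg (fun w : VV => w.coeff 0) h0
      have e := coeff_CT u 0 0
      simp only [LaurentPolynomial.T_zero, mul_one, if_true] at e
      simp only [e] at this
      exact hu0' (by simpa using this)
    apply mul_left_cancel₀ hC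
    have h' := congrArg (C : Polynomial ℂ →+* VV) h
    rw [map_mul, map_mul] at h'
    linear_combination (D dP c y) * h' + C (Polynomial.derivative u) * hv1'
  have h1 := parts c u I e0 e1 hI hu0 hu1 Δ y
  have h2 : I (C (Polynomial.derivative u) * v1) = 0 := by
    have := (mem_UU u I 0 v1).1 hv1 1
    rw [Lam_apply] at this
    simpa using this
  have h3 : Lam u I (Polynomial.derivative Δ) y = 0 := by
    have := (mem_UU u I 0 y).1 hyU (Polynomial.derivative Δ)
    simpa using this
  rw [key, h2, h3, hΔ] at h1
  have hev : ∀ e : VV →ₐ[ℂ] ℂ, e (C η) = 0 → e y = (pp u.natDegree).eval 0 * e v := by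
    intro e he
    have := aeval_eigen (Th c η) ⊤ (fun _ _ => trivial) e.toLinearMap 0
      (fun w _ => by simp [Th_apply, he]) (pp u.natDegree) v trivial
    simpa using this
  rw [hev e0 he0, hev e1 he1] at h1
  have h4 : (pp u.natDegree).eval 0 ≠ 0 := by simpa using pp_int u.natDegree 0
  apply mul_left_cancel₀ h4
  linear_combination -h1

end A
end MV

namespace MV
open LaurentPolynomial

section germ
open PowerSeries

lemma expE (β : ℂ⟦X⟧) (hβ : constantCoeff β = 0) :
    ∃ E : ℂ⟦X⟧ˣ, constantCoeff (E : ℂ⟦X⟧) = 1 ∧ derivative ℂ (E : ℂ⟦X⟧) = derivative ℂ β * E := by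
  have hs : HasSubst β := HasSubst.of_constantCoeff_zero' hβ
  have h1 : constantCoeff ((PowerSeries.exp ℂ).subst β) = 1 := by
    have h2 := constantCoeff_subst_eq_zero hβ (PowerSeries.exp ℂ - 1) (by simp)
    rw [PowerSeries.subst_sub hs] at h2
    have h3 : (1 : ℂ⟦X⟧).subst β = (1 : ℂ⟦X⟧) := by
      rw [← PowerSeries.coe_substAlgHom hs, map_one]
    rw [h3, map_sub, map_one, sub_eq_zero] at h2
    exact h2
  have hu : IsUnit ((PowerSeries.exp ℂ).subst β : ℂ⟦X⟧) := by
    rw [PowerSeries.isUnit_iff_constantCoeff, h1]; exact isUnit_one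
  obtain ⟨E, hE⟩ := hu
  refine ⟨E, by rw [hE, h1], ?_⟩
  rw [hE, derivative_subst hs, derivative_exp, mul_comm]

lemma d_aeval (g : ℂ⟦X⟧) (p : Polynomial ℂ) : derivative ℂ (Polynomial.aeval g p) =
    Polynomial.aeval g (Polynomial.derivative p) * derivative ℂ g := by
  rw [Derivation.comp_aeval_eq (a := g) (derivative ℂ) p, smul_eq_mul]

lemma germ (u : Polynomial ℂ) (hu : u ≠ 0) (s : ℂ) (hs : u.eval s = 0) (r : ℕ) (hr : 0 < r) :
    ∃ β : ℂ⟦X⟧, constantCoeff β = 0 ∧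
      Polynomial.aeval (algebraMap ℂ ℂ⟦X⟧ s + β) u = X ^ (u.rootMultiplicity s * r) := by
  obtain ⟨k, hk, hks⟩ := Polynomial.exists_eq_pow_rootMultiplicity_mul_and_not_dvd u hu s
  have he : 0 < u.rootMultiplicity s := (Polynomial.rootMultiplicity_pos hu).2 hs
  have hk0 : (k.comp (Polynomial.X + Polynomial.C s)).eval 0 ≠ 0 := by
    simp only [Polynomial.eval_comp, Polynomial.eval_add, Polynomial.eval_X, Polynomial.eval_C, zero_add]
    intro h; exact hks (Polynomial.dvd_iff_isRoot.2 h)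
  obtain ⟨b, hb0, hb⟩ := solveA _ hk0 _ r he hr
  refine ⟨X ^ r * b, by simp [hr.ne'], ?_⟩
  have e2 : Polynomial.aeval (X ^ r * b) (k.comp (Polynomial.X + Polynomial.C s)) =
    Polynomial.aeval (algebraMap ℂ ℂ⟦X⟧ s + X ^ r * b) k := by
    rw [Polynomial.aeval_comp]
    congr 2
    simp [add_comm]
  rw [e2] at hb
  generalize u.rootMultiplicity s = e at *
  rw [hk, map_mul, map_pow, map_sub, Polynomial.aeval_X, Polynomial.aeval_C, add_sub_cancel_left,
    mul_pow, mul_assoc, hb, mul_one, ← pow_mul, mul_comm]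

/-- germ homomorphism -/
def gh (s : ℂ) (β : ℂ⟦X⟧) (E : ℂ⟦X⟧ˣ) : VV →ₐ[ℂ] ℂ⟦X⟧ :=
  lft (Polynomial.aeval (algebraMap ℂ ℂ⟦X⟧ s + β)) E

lemma gh_chain (c s : ℂ) (β : ℂ⟦X⟧) (E : ℂ⟦X⟧ˣ)
    (hE : derivative ℂ (E : ℂ⟦X⟧) = derivative ℂ (c • β) * E) (v : VV) :
    derivative ℂ (gh s β E v) = gh s β E (MV.D dP c v) * derivative ℂ β := by
  apply chain_rule
  · intro p
    rw [gh, lft_C, lft_C]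
    show derivative ℂ (Polynomial.aeval _ p) = Polynomial.aeval _ (Polynomial.derivative p) * _
    rw [d_aeval, map_add, Derivation.map_algebraMap, zero_add]
  · rw [gh, lft_T, zpow_one, hE, Derivation.map_smul, smul_mul_assoc, mul_comm]

lemma gh_cc (s z : ℂ) (hz : z ≠ 0) (β : ℂ⟦X⟧) (E : ℂ⟦X⟧ˣ) (hβ : constantCoeff β = 0)
    (hE : constantCoeff (E : ℂ⟦X⟧) = z) (v : VV) :
    constantCoeff (gh s β E v) = lft (Polynomial.aeval s) (Units.mk0 z hz) v := by
  have hu : Units.map (constantCoeff (R := ℂ)).toMonoidHom E = Units.mk0 z hz := by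
    ext; simpa using hE
  induction v using LaurentPolynomial.induction_on' with
  | add p q hp hq => simp only [map_add, hp, hq]
  | C_mul_T j p =>
    simp only [gh, map_mul, lft_C, lft_T]
    congr 1
    · induction p using Polynomial.induction_on' with
      | add p q hp hq => simp only [map_add, hp, hq]
      | monomial n a => simp [Polynomial.aeval_monomial, hβ]
    · rw [← hu, ← map_zpow]; rfl

lemma gh_Th (c s : ℂ) (u η Δ : Polynomial ℂ) (h : u * Δ.comp u = η * Polynomial.derivative u)
    (β : ℂ⟦X⟧) (E : ℂ⟦X⟧ˣ) (hE : derivative ℂ (E : ℂ⟦X⟧) = derivative ℂ (c • β) * E)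
    (m : ℕ) (hm : 0 < m) (hβ : Polynomial.aeval (algebraMap ℂ ℂ⟦X⟧ s + β) u = X ^ m) (v : VV) :
    (m : ℂ) • gh s β E (Th c η v) = Polynomial.aeval (X ^ m : ℂ⟦X⟧) Δ * (X * derivative ℂ (gh s β E v)) := by
  rw [gh_chain c s β E hE, Th_apply, map_mul]
  have h0 : gh s β E (C η) = Polynomial.aeval (algebraMap ℂ ℂ⟦X⟧ s + β) η := by rw [gh, lft_C]
  rw [h0]
  have h1 := congrArg (Polynomial.aeval (algebraMap ℂ ℂ⟦X⟧ s + β)) h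
  rw [map_mul, map_mul, Polynomial.aeval_comp, hβ] at h1
  have h2 := congrArg (derivative ℂ) hβ
  rw [d_aeval] at h2
  have h3 : derivative ℂ (X ^ m : ℂ⟦X⟧) = (m : ℂ⟦X⟧) * X ^ (m - 1) := by
    rw [Derivation.leibniz_pow]; simp
  rw [h3] at h2
  have h4 : derivative ℂ (algebraMap ℂ ℂ⟦X⟧ s + β) = derivative ℂ β := by simp
  rw [h4] at h2
  obtain ⟨k, rfl⟩ : ∃ k, m = k + 1 := ⟨m - 1, by omega⟩
  simp only [Nat.add_sub_cancel] at h2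
  have hX : (X : ℂ⟦X⟧) ^ k ≠ 0 := pow_ne_zero _ X_ne_zero
  have h5 : ((k + 1 : ℕ) : ℂ) • (Polynomial.aeval (algebraMap ℂ ℂ⟦X⟧ s + β) η) =
      Polynomial.aeval (X ^ (k + 1) : ℂ⟦X⟧) Δ * X * derivative ℂ β := by
    apply mul_left_cancel₀ hX
    rw [Nat.cast_smul_eq_nsmul, nsmul_eq_mul]
    linear_combination (-Polynomial.aeval (algebraMap ℂ ℂ⟦X⟧ s + β) η) * h2 - derivative ℂ β * h1
  rw [← smul_mul_assoc, h5]; ring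

end germ
end MV

namespace MV
open LaurentPolynomial

section coef
open PowerSeries

/-- coefficients at multiples of `m` up to `mk` vanish -/
def ZZ (m k : ℕ) (f : ℂ⟦X⟧) : Prop := ∀ j ≤ k, coeff (m * j) f = 0

lemma ZZ_X (m k : ℕ) (hm : 0 < m) (f : ℂ⟦X⟧) (hf : ZZ m k f) : ZZ m (k + 1) (X ^ m * f) := by
  intro j hj
  rcases j with _ | j
  · rw [mul_zero, coeff_zero_eq_constantCoeff, map_mul]; simp [hm.ne']
  · rw [mul_add, mul_one, mul_comm (X ^ m), coeff_mul_X_pow]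
    exact hf j (by omega)

lemma ZZ_aeval (m k : ℕ) (hm : 0 < m) (q : Polynomial ℂ) : ∀ f : ℂ⟦X⟧, ZZ m k f →
    ZZ m k (Polynomial.aeval (X ^ m : ℂ⟦X⟧) q * f) := by
  induction q using Polynomial.induction_on with
  | C a => intro f hf j hj; rw [Polynomial.aeval_C, ← Algebra.smul_def]; simp [hf j hj]
  | add p q hp hq => intro f hf j hj; rw [map_add, add_mul, map_add, hp f hf j hj, hq f hf j hj, add_zero]
  | monomial n a ih =>
    intro f hf
    rw [pow_succ, ← mul_assoc, map_mul, Polynomial.aeval_X, mul_assoc]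
    exact ih _ fun j hj => ZZ_X m k hm f hf j (by omega)

lemma coeff_Xd (f : ℂ⟦X⟧) (n : ℕ) : coeff n (X * derivative ℂ f) = n * coeff n f := by
  rcases n with _ | n
  · simp
  · rw [mul_comm, coeff_succ_mul_X, coeff_derivative]; push_cast; ring

lemma coeff_vanish (c : ℂ) (u η Δ : Polynomial ℂ) (hΔ : Δ.eval 0 = 1) (K : Submodule ℂ VV)
    (hK : ∀ v ∈ K, Th c η v ∈ K) (N : VV →ₗ[ℂ] ℂ⟦X⟧) (m : ℕ) (hm : 0 < m)
    (hN1 : ∀ v, (m : ℂ) • N (Th c η v) = Polynomial.aeval (X ^ m : ℂ⟦X⟧) Δ * (X * derivative ℂ (N v)))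
    (hN2 : ∀ v, N (LaurentPolynomial.C u * v) = X ^ m * N v) (hN0 : ∀ v ∈ K, constantCoeff (N v) = 0)
    (M : ℕ)
    (hK2 : ∀ v ∈ K, ∃ v1 ∈ K, Polynomial.aeval (Th c η) (Polynomial.X * pp M) v = LaurentPolynomial.C u * v1)
    (k : ℕ) : ∀ v ∈ K, ZZ m k (N v) := by
  have hm0 : (m : ℂ) ≠ 0 := by exact_mod_cast hm.ne'
  induction k with
  | zero => intro v hv j hj; obtain rfl : j = 0 := by omega
            simpa using hN0 v hv
  | succ k ih =>
    intro v hv j hj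
    rcases Nat.lt_or_ge j (k + 1) with hj' | hj'
    · exact ih v hv j (by omega)
    obtain rfl : j = k + 1 := by omega
    obtain ⟨Δ', hΔ'⟩ : Polynomial.X ∣ Δ - 1 := by
      rw [← sub_zero Polynomial.X, ← map_zero Polynomial.C, Polynomial.dvd_iff_isRoot]; simp [hΔ]
    have hΔ2 : Δ = 1 + Polynomial.X * Δ' := by rw [← hΔ']; ring
    have heig : ∀ v ∈ K, coeff (m * (k + 1)) (N (Th c η v)) = (k + 1 : ℂ) * coeff (m * (k + 1)) (N v) := by
      intro v hv
      have h1 := congrArg (coeff (m * (k + 1))) (hN1 v)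
      rw [hΔ2, map_add, map_one, map_mul (Polynomial.aeval (X ^ m : ℂ⟦X⟧)), Polynomial.aeval_X, add_mul, one_mul, map_add, coeff_Xd,
        mul_assoc] at h1
      have h2 : ZZ m k (X * derivative ℂ (N v)) := by
        intro j hj
        rw [coeff_Xd, ih v hv j hj, mul_zero]
      have h3 := ZZ_X m k hm _ (ZZ_aeval m k hm Δ' _ h2) (k + 1) le_rfl
      rw [h3, add_zero, map_smul, smul_eq_mul] at h1
      apply mul_left_cancel₀ hm0
      rw [h1]; push_cast; ring
    have h4 := aeval_eigen (Th c η) K hK ((coeff (m * (k + 1))) ∘ₗ N) (k + 1 : ℂ)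
      (fun v hv => heig v hv) (Polynomial.X * pp M) v hv
    obtain ⟨v1, hv1, e⟩ := hK2 v hv
    rw [e, LinearMap.comp_apply, LinearMap.comp_apply, hN2] at h4
    rw [ZZ_X m k hm _ (ih v1 hv1) (k + 1) le_rfl] at h4
    have h5 : (Polynomial.X * pp M).eval (k + 1 : ℂ) ≠ 0 := by
      rw [Polynomial.eval_mul, Polynomial.eval_X]
      refine mul_ne_zero (by exact_mod_cast Nat.succ_ne_zero k) ?_
      have := pp_int M (k + 1)
      push_cast at this
      exact this
    exact (mul_eq_zero.1 h4.symm).resolve_left h5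

lemma sum_root (m : ℕ) (ω : ℂ) (hω : IsPrimitiveRoot ω m) (n : ℕ) (hn : ¬ m ∣ n) :
    ∑ i : Fin m, (ω ^ (i : ℕ)) ^ n = 0 := by
  have h1 : ω ^ n ≠ 1 := fun h => hn (hω.dvd_of_pow_eq_one n h)
  have h2 := mul_geom_sum (ω ^ n) m
  rw [← pow_mul, mul_comm n m, pow_mul, hω.pow_eq_one, one_pow, sub_self] at h2
  have h3 := (mul_eq_zero.1 h2).resolve_left (sub_ne_zero.2 h1)
  rw [Finset.sum_range] at h3
  rw [← h3]
  exact Finset.sum_congr rfl fun i _ => by rw [← pow_mul, ← pow_mul, mul_comm]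

lemma sum_rescale (m : ℕ) (ω : ℂ) (hω : IsPrimitiveRoot ω m) (f : ℂ⟦X⟧) (hf : ∀ k, coeff (m * k) f = 0) :
    ∑ i : Fin m, rescale (ω ^ (i : ℕ)) f = 0 := by
  ext n
  rw [map_sum]
  simp only [coeff_rescale]
  rw [← Finset.sum_mul]
  by_cases hn : m ∣ n
  · obtain ⟨k, rfl⟩ := hn; simp [hf]
  · rw [sum_root m ω hω n hn]; simp

end coef

lemma indep {G L ι : Type*} [Monoid G] [CommRing L] [IsDomain L] [CharZero L] [Fintype ι]
    (A B : ι → G →* L) (h : ∀ g, ∑ i, A i g = ∑ i, B i g) (i : ι) : ∃ j, A i = B j := by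
  classical
  by_contra hcon
  push Not at hcon
  have hli := linearIndependent_iff.1 (linearIndependent_monoidHom G L)
    (∑ j, Finsupp.single (A j) 1 - ∑ j, Finsupp.single (B j) 1) (by
      ext g
      simp [map_sub, map_sum, Finsupp.linearCombination_single, h g])
  have h1 := DFunLike.congr_fun hli (A i)
  simp only [Finsupp.sub_apply, Finsupp.finsetSum_apply, Finsupp.zero_apply, Finsupp.single_apply] at h1
  rw [Finset.sum_eq_zero (s := Finset.univ) (f := fun j => if B j = A i then (1 : L) else 0), sub_zero,
    Finset.sum_boole] at h1
  · have h2 := Nat.cast_eq_zero.1 h1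
    rw [Finset.card_eq_zero] at h2
    have : i ∈ (Finset.univ.filter fun j => A j = A i) := by simp
    rw [h2] at this
    simp at this
  · intro j _
    rw [if_neg]; exact fun e => hcon j e.symm

/-- measure for injectivity -/
def mu (v : VV) : ℕ := ∑ j ∈ v.coeff.support, ((v.coeff j).natDegree + 1)

lemma inj_aux (c : ℂ) (hc : c ≠ 0) (K : Submodule ℂ VV) (hK : ∀ v ∈ K, D dP c v ∈ K)
    (hK0 : ∀ (a : ℂ) (j : ℤ), (C (Polynomial.C a) * T j : VV) ∈ K → a = 0) (n : ℕ) :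
    ∀ v ∈ K, mu v ≤ n → v = 0 := by
  induction n with
  | zero =>
    intro v hv hmu
    by_contra h0
    have hs : v.coeff.support.Nonempty := by
      rw [Finset.nonempty_iff_ne_empty]
      intro h
      exact h0 (by rw [eq_sum_CT v _ le_rfl, h]; simp)
    obtain ⟨j, hj⟩ := hs
    have := Finset.single_le_sum (f := fun j => (v.coeff j).natDegree + 1) (fun _ _ => Nat.zero_le _) hj
    simp only [mu] at hmu
    omega
  | succ n ih =>
    intro v hv hmu
    by_contra h0
    have hs : v.coeff.support.Nonempty := by
      rw [Finset.nonempty_iff_ne_empty]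
      intro h
      exact h0 (by rw [eq_sum_CT v _ le_rfl, h]; simp)
    obtain ⟨j, hj⟩ := hs
    set w := D dP c v - (c * j) • v with hw
    have hwK : w ∈ K := K.sub_mem (hK v hv) (K.smul_mem _ hv)
    have hcoef : ∀ k, w.coeff k = Polynomial.derivative (v.coeff k) + (c * (k - j)) • v.coeff k := by
      intro k
      rw [hw]
      simp only [AddMonoidAlgebra.coeff_sub, Finsupp.sub_apply, coeff_D, AddMonoidAlgebra.coeff_smul, Finsupp.smul_apply]
      rw [mul_sub, sub_smul, add_sub_assoc]; rfl
    have hdeg : ∀ p : Polynomial ℂ, ∀ b : ℂ, (Polynomial.derivative p + b • p).natDegree ≤ p.natDegree := by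
      intro p b
      refine (Polynomial.natDegree_add_le _ _).trans (max_le ?_ (Polynomial.natDegree_smul_le _ _))
      exact (Polynomial.natDegree_derivative_le p).trans (Nat.sub_le _ _)
    have hsub : w.coeff.support ⊆ v.coeff.support := by
      intro k hk
      rw [Finsupp.mem_support_iff] at *
      intro h; apply hk; rw [hcoef, h]; simp
    have hmuw : mu w ≤ n := by
      by_cases hjw : j ∈ w.coeff.support
      · have : mu w < mu v := by
          refine lt_of_lt_of_le (Finset.sum_lt_sum (g := fun k => (v.coeff k).natDegree + 1) ?_ ⟨j, hjw, ?_⟩)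
            (Finset.sum_le_sum_of_subset hsub)
          · intro k _; rw [hcoef]; exact Nat.add_le_add_right (hdeg _ _) 1
          · have h1 := hcoef j
            simp only [sub_self, mul_zero, zero_smul, add_zero] at h1
            rw [Finsupp.mem_support_iff, h1] at hjw
            rw [h1]
            have : (v.coeff j).natDegree ≠ 0 := by
              intro h
              rw [Polynomial.natDegree_eq_zero] at h
              obtain ⟨a, ha⟩ := h
              rw [← ha] at hjw; simp at hjw
            have := Polynomial.natDegree_derivative_lt this
            omega
        omega
      · have hsub' : w.coeff.support ⊆ v.coeff.support.erase j := by
          intro k hk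
          rw [Finset.mem_erase]
          exact ⟨fun h => hjw (h ▸ hk), hsub hk⟩
        have h1 : mu w ≤ ∑ k ∈ v.coeff.support.erase j, ((v.coeff k).natDegree + 1) := by
          refine (Finset.sum_le_sum (g := fun k => (v.coeff k).natDegree + 1) ?_).trans
            (Finset.sum_le_sum_of_subset hsub')
          intro k _; rw [hcoef]; exact Nat.add_le_add_right (hdeg _ _) 1
        have h2 := Finset.add_sum_erase v.coeff.support (fun k => (v.coeff k).natDegree + 1) hj
        simp only [mu] at hmu h1 ⊢
        omega
    have hw0 := ih w hwK hmuw
    rw [hw0] at hcoef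
    have hz : ∀ k, k ≠ j → v.coeff k = 0 := by
      intro k hk
      by_contra hne
      have h1 := hcoef k
      simp only [AddMonoidAlgebra.coeff_zero, Finsupp.coe_zero, Pi.zero_apply] at h1
      have hb : c * ((k : ℂ) - j) ≠ 0 := mul_ne_zero hc (sub_ne_zero.2 (by exact_mod_cast hk))
      have h2 : (c * ((k : ℂ) - j)) • v.coeff k = - Polynomial.derivative (v.coeff k) := by
        linear_combination (-1 : Polynomial ℂ) * h1
      have h3 : (v.coeff k).degree = (Polynomial.derivative (v.coeff k)).degree := by
        rw [← Polynomial.degree_neg (Polynomial.derivative _), ← h2, Polynomial.smul_eq_C_mul, Polynomial.degree_C_mul hb]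
      exact (Polynomial.degree_derivative_lt hne).ne h3.symm
    have hj1 := hcoef j
    simp only [AddMonoidAlgebra.coeff_zero, Finsupp.coe_zero, Pi.zero_apply, sub_self, mul_zero, zero_smul, add_zero] at hj1
    obtain ⟨a, ha⟩ : ∃ a, v.coeff j = Polynomial.C a :=
      ⟨_, Polynomial.eq_C_of_natDegree_eq_zero (Polynomial.derivative_eq_zero.1 hj1.symm)⟩
    have hv' : v = C (Polynomial.C a) * T j := by
      rw [eq_sum_CT v {j} (by
        intro k hk
        rw [Finsupp.mem_support_iff] at hk
        by_contra h
        exact hk (hz k (by simpa using h)))]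
      simp [ha]
    rw [hv'] at hv
    have := hK0 a j hv
    rw [Finsupp.mem_support_iff, ha, this] at hj
    simp at hj

end MV

namespace MV
open LaurentPolynomial

/-- the unit `z` -/
def TU (R : Type*) [CommRing R] : (R[T;T⁻¹])ˣ := ⟨T 1, T (-1), by rw [← T_add]; simp, by rw [← T_add]; simp⟩

lemma TU_zpow (R : Type*) [CommRing R] (j : ℤ) : ((TU R ^ j : (R[T;T⁻¹])ˣ) : R[T;T⁻¹]) = T j := by
  induction j using Int.induction_on with
  | zero => simp
  | succ n ih => rw [zpow_add_one, Units.val_mul, ih, TU, ← T_add]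
  | pred n ih => rw [zpow_sub_one, Units.val_mul, ih, TU, Units.inv_mk, ← T_add]; rfl

/-- inclusion of trigonometric polynomials -/
def iota : ℂ[T;T⁻¹] →ₐ[ℂ] VV := lft (Algebra.ofId ℂ VV) (TU _)

lemma iota_T (j : ℤ) : iota (T j) = T j := by rw [iota, lft_T, TU_zpow]
lemma iota_C (a : ℂ) : iota (C a) = algebraMap ℂ VV a := by rw [iota, lft_C]; rfl

lemma alg_gen {V : Type*} [CommRing V] [Algebra ℂ V] (R : Subalgebra ℂ V) (x y : V) (f : Polynomial ℂ) (n : ℕ)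
    (hy : y ∈ R) (h : Polynomial.aeval x f = y * x ^ n) (hns : ∀ a, y ≠ algebraMap ℂ V a) : IsAlgebraic R x := by
  refine ⟨f.map (algebraMap ℂ R) - Polynomial.C (⟨y, hy⟩ : R) * Polynomial.X ^ n, ?_, ?_⟩
  · intro h
    have h1 := congrArg (fun q => ((Polynomial.coeff q n : R) : V)) h
    simp only [Polynomial.coeff_sub, Polynomial.coeff_map, Polynomial.coeff_C_mul_X_pow, if_true, Polynomial.coeff_zero] at h1
    have h2 : algebraMap ℂ V (f.coeff n) - y = 0 := h1
    exact hns _ (sub_eq_zero.1 h2).symm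
  · rw [map_sub, Polynomial.aeval_map_algebraMap, map_mul, Polynomial.aeval_C, map_pow, Polynomial.aeval_X, h]
    show y * x ^ n - y * x ^ n = 0
    rw [sub_self]

lemma alg_C (R : Subalgebra ℂ VV) (u : Polynomial ℂ) (hu : C u ∈ R) (hu' : 0 < u.natDegree) (p : Polynomial ℂ) :
    IsAlgebraic R (C p : VV) := by
  have hX : IsAlgebraic R (C Polynomial.X : VV) := by
    refine alg_gen R _ (C u) u 0 hu ?_ ?_
    · have : ∀ q : Polynomial ℂ, Polynomial.aeval (C Polynomial.X : VV) q = C q := by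
        intro q
        induction q using Polynomial.induction_on with
        | C a => rw [Polynomial.aeval_C]; rfl
        | add p q hp hq => simp [hp, hq]
        | monomial n a ih => rw [pow_succ, ← mul_assoc, map_mul, ih]; simp
      rw [this, pow_zero, mul_one]
    · intro a h1
      have h2 : algebraMap ℂ VV a - C u = 0 := by rw [h1, sub_self]
      have h3 : (C (Polynomial.C a - u) : VV) * T 0 = 0 := by
        rw [map_sub]; simpa using h2
      have h4 := congrArg (fun w : VV => w.coeff 0) h3
      simp only [coeff_CT, if_true] at h4
      have h5 : u = Polynomial.C a := (sub_eq_zero.1 (by simpa using h4)).symm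
      rw [h5] at hu'; simp at hu'
  induction p using Polynomial.induction_on with
  | C a => exact isAlgebraic_algebraMap (algebraMap ℂ R a)
  | add p q hp hq => rw [map_add]; exact hp.add hq
  | monomial n a ih => rw [pow_succ, ← mul_assoc, map_mul]; exact ih.mul hX

lemma alg_T (R : Subalgebra ℂ VV) (g : ℂ[T;T⁻¹]) (hg : iota g ∈ R) (hns : ∀ a, iota g ≠ algebraMap ℂ VV a) (j : ℤ) :
    IsAlgebraic R (T j : VV) := by
  have h1 : IsAlgebraic R (T 1 : VV) := by
    obtain ⟨n, f, hf⟩ := LaurentPolynomial.exists_T_pow g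
    refine alg_gen R _ (iota g) f n hg ?_ hns
    · skip
      have : ∀ q : Polynomial ℂ, Polynomial.aeval (T 1 : VV) q = iota (Polynomial.toLaurent q) := by
        intro q
        induction q using Polynomial.induction_on with
        | C a => rw [Polynomial.aeval_C, Polynomial.toLaurent_C, iota_C]
        | add p q hp hq => simp [hp, hq]
        | monomial n a ih => rw [pow_succ, ← mul_assoc, map_mul, ih, map_mul Polynomial.toLaurent _ Polynomial.X,
            map_mul iota, Polynomial.toLaurent_X, iota_T, Polynomial.aeval_X]
      rw [this, hf, map_mul, iota_T, T_pow]; simp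
  have h2 : IsAlgebraic R (T (-1) : VV) := by
    let : Invertible (T 1 : VV) := ⟨T (-1), by rw [← T_add]; simp, by rw [← T_add]; simp⟩
    have : (⅟ (T 1 : VV)) = T (-1) := rfl
    rw [← this]
    exact IsAlgebraic.invOf_iff.2 h1
  rcases Int.eq_nat_or_neg j with ⟨n, rfl | rfl⟩
  · have := h1.pow n
    rw [T_pow] at this; simpa using this
  · have := h2.pow n
    rw [T_pow] at this; simpa using this

lemma ode_poly (b : ℂ) (n : ℕ) : ∀ p : Polynomial ℂ, p.natDegree ≤ n → ∃ q : Polynomial ℂ,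
    Polynomial.derivative q + b • q = p := by
  by_cases hb : b = 0
  · intro p hn0
    clear hn0
    simp only [hb, zero_smul, add_zero]
    induction p using Polynomial.induction_on' with
    | add p q hp hq =>
      obtain ⟨a, rfl⟩ := hp; obtain ⟨b, rfl⟩ := hq
      exact ⟨a + b, map_add _ _ _⟩
    | monomial n a =>
      refine ⟨Polynomial.monomial (n + 1) (a / (n + 1)), ?_⟩
      rw [Polynomial.derivative_monomial]
      have : (n + 1 : ℂ) ≠ 0 := by exact_mod_cast Nat.succ_ne_zero n
      simp [div_mul_cancel₀ a this]
  · induction n with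
    | zero =>
      intro p hp
      obtain ⟨a, rfl⟩ := Polynomial.natDegree_eq_zero.1 (Nat.le_zero.1 hp)
      exact ⟨Polynomial.C (a / b), by simp [Polynomial.smul_C, mul_div_cancel₀ a hb]⟩
    | succ n ih =>
      intro p hp
      obtain ⟨q, hq⟩ := ih (Polynomial.derivative p)
        ((Polynomial.natDegree_derivative_le p).trans (by omega))
      refine ⟨b⁻¹ • (p - q), ?_⟩
      rw [smul_smul, mul_inv_cancel₀ hb, one_smul, Polynomial.derivative_smul, map_sub, ← hq]
      rw [add_sub_cancel_left, smul_smul, inv_mul_cancel₀ hb, one_smul]; ring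

lemma D_surj (c : ℂ) (w : VV) : ∃ v, D dP c v = w := by
  induction w using LaurentPolynomial.induction_on' with
  | add p q hp hq => obtain ⟨a, rfl⟩ := hp; obtain ⟨b, rfl⟩ := hq; exact ⟨a + b, map_add _ _ _⟩
  | C_mul_T j p =>
    obtain ⟨q, hq⟩ := ode_poly (c * j) _ p le_rfl
    exact ⟨C q * T j, by rw [D_CT]; congr 2⟩

/-- evaluation -/
def evA (c : ℂ) (x : ℝ) : VV →ₐ[ℂ] ℂ := lft (Polynomial.aeval (x : ℂ)) (expu c x)

lemma evA_C (c : ℂ) (x : ℝ) (p : Polynomial ℂ) : evA c x (C p) = p.eval (x : ℂ) := by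
  rw [evA, lft_C, Polynomial.coe_aeval_eq_eval]

lemma evA_der (c : ℂ) (v : VV) (x : ℝ) : HasDerivAt (fun x => evA c x v) (evA c x (D dP c v)) x := by
  apply ev_der
  intro p x
  have h := (p.hasDerivAt (x : ℂ)).comp_ofReal
  simpa [Polynomial.coe_aeval_eq_eval] using h

end MV

namespace MV
open LaurentPolynomial

lemma words_gen {V Ω : Type*} [CommRing V] [IsDomain V] [Algebra ℂ V] [CommRing Ω] [Algebra ℂ Ω]
    (D : V →ₗ[ℂ] V) (ev : ℝ → V →ₐ[ℂ] ℂ) (T : ℝ) (hT : 0 < T) (n : ℕ) (a : Fin n → ℝ → ℂ)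
    (hev : ∀ v x, HasDerivAt (fun x => ev x v) (ev x (D v)) x)
    (G : Fin n → V) (ha : ∀ i, ∀ x ∈ Icc (0:ℝ) T, a i x = ev x (D (G i)))
    (R : Subalgebra ℂ V) (hGR : ∀ i, G i ∈ R) (φ0 φ1 : V →ₐ[ℂ] Ω) (hinj : Function.Injective φ0)
    (hR : ∀ r ∈ R, φ0 r = φ1 r) (d : Derivation ℂ Ω Ω)
    (hd : ∀ f, d f = 0 → ∃ κ : ℂ, f = algebraMap ℂ Ω κ) (w0 w1 : Ω)
    (hw0 : ∀ v, d (φ0 v) = φ0 (D v) * w0) (hw1 : ∀ v, d (φ1 v) = φ1 (D v) * w1)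
    (S : V → Prop) (hS : ∀ F, S F → IsAlgebraic R F) (hS1 : S 1)
    (hS2 : ∀ F i, S F → φ0 F = φ1 F → ∃ F', S F' ∧ D F' = D (G i) * F ∧ ev 0 F' = 0)
    (hev1 : ∀ F, φ0 F = φ1 F → ev T F = ev 0 F) :
    ∀ l : List (Fin n), l ≠ [] → iterInt T a l = 0 := by
  refine word_lemma D ev T hT n a hev G ha (fun F => S F ∧ φ0 F = φ1 F) ⟨hS1, by simp⟩ ?_
  rintro F i ⟨hSF, hF⟩
  obtain ⟨F', hSF', hDF', h0⟩ := hS2 F i hSF hF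
  have key : φ0 F' = φ1 F' := by
    have e0 : d (φ0 F') = d (φ0 (G i)) * φ0 F := by rw [hw0, hw0, hDF', map_mul]; ring
    have e1 : d (φ1 F') = d (φ1 (G i)) * φ1 F := by rw [hw1, hw1, hDF', map_mul]; ring
    obtain ⟨κ, hκ⟩ := hd (φ1 F' - φ0 F') (by
      rw [map_sub, e0, e1, hF, hR _ (hGR i), sub_self])
    have := kappa R F' (hS F' hSF') φ0 φ1 hinj hR κ (by rw [← hκ]; ring)
    rw [this, map_zero, sub_eq_zero] at hκ
    exact hκ.symm
  exact ⟨F', ⟨hSF', key⟩, hDF', h0, by rw [hev1 F' key, h0]⟩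

section A
open PowerSeries

lemma deriv_rescale (ζ : ℂ) (f : ℂ⟦X⟧) : derivative ℂ (rescale ζ f) = rescale ζ (derivative ℂ f) * algebraMap ℂ ℂ⟦X⟧ ζ := by
  rw [mul_comm, ← Algebra.smul_def]
  ext n
  rw [coeff_derivative, coeff_rescale, map_smul, coeff_rescale, coeff_derivative, smul_eq_mul]; ring

/-- integration functional -/
def IA (c : ℂ) (T : ℝ) : VV →ₗ[ℂ] ℂ where
  toFun v := ∫ x in (0:ℝ)..T, evA c x v
  map_add' v w := by
    simp only [map_add]
    exact intervalIntegral.integral_add ((ev_cont _ _ (evA_der c) v).intervalIntegrable _ _)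
      ((ev_cont _ _ (evA_der c) w).intervalIntegrable _ _)
  map_smul' a v := by
    simp only [map_smul, RingHom.id_apply]
    exact intervalIntegral.integral_smul _ _

set_option maxHeartbeats 2000000 in
theorem caseA (T : ℝ) (hT : 0 < T) (n : ℕ) (a : Fin n → ℝ → ℂ) (c : ℂ) (hc : c ≠ 0)
    (hcT : Complex.exp (c * T) = 1) (G : Fin n → VV)
    (ha : ∀ i, ∀ x ∈ Icc (0:ℝ) T, a i x = evA c x (MV.D dP c (G i)))
    (hG : ∀ i, evA c 0 (G i) = 0)
    (hm : ∀ (ps : List (Fin n × ℕ)), (∀ q ∈ ps, 0 < q.2) → ∀ i : Fin n, moment T a ps i = 0)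
    (hform : ∀ i, (∃ p, G i = LaurentPolynomial.C p) ∨ (∃ g, G i = iota g))
    (i0 : Fin n) (u : Polynomial ℂ) (hi0 : G i0 = LaurentPolynomial.C u) (hu : 0 < u.natDegree) :
    ∀ l : List (Fin n), l ≠ [] → iterInt T a l = 0 := by
  have hcz : CharZero ℂ⟦X⟧ := charZero_of_injective_algebraMap (FaithfulSMul.algebraMap_injective ℂ ℂ⟦X⟧)
  have hu0' : u ≠ 0 := by rintro rfl; simp at hu
  set R := Algebra.adjoin ℂ (Set.range G) with hRdef
  have hGR : ∀ i, G i ∈ R := fun i => Algebra.subset_adjoin ⟨i, rfl⟩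
  have huR : (LaurentPolynomial.C u : VV) ∈ R := hi0 ▸ hGR i0
  have hmom := moments_int (MV.D dP c) (evA c) T hT n a (evA_der c) (D_mul dP c) G ha hG hm
  set I := IA c T with hIdef
  have hI : ∀ v, I (MV.D dP c v) = evA c T v - evA c 0 v := fun v => ev_ftc _ _ (evA_der c) v 0 T
  have he0 : evA c 0 (LaurentPolynomial.C u) = 0 := hi0 ▸ hG i0
  have he1 : evA c T (LaurentPolynomial.C u) = 0 := by
    have h1 := hmom 1 (one_mem _) _ huR
    rw [one_mul] at h1
    have h2 : I (MV.D dP c (LaurentPolynomial.C u)) = 0 := h1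
    rw [hI, he0, sub_zero] at h2
    exact h2
  obtain ⟨η, Δ, hηΔ, hΔ⟩ := exists_eta u hu
  have hη : ∀ s : ℂ, u.eval s = 0 → η.eval s = 0 := by
    intro s hs
    obtain ⟨η1, h1, -⟩ := eta_local u η Δ hηΔ hΔ hu0' s hs
    rw [h1]; simp
  have hs0 : u.eval 0 = 0 := by simpa [evA_C] using he0
  have hs1 : u.eval (T : ℂ) = 0 := by simpa [evA_C] using he1
  have heη0 : evA c 0 (LaurentPolynomial.C η) = 0 := by rw [evA_C]; simpa using hη 0 hs0
  have heη1 : evA c T (LaurentPolynomial.C η) = 0 := by rw [evA_C]; exact hη T hs1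
  -- R in the kernel
  have hcompR : ∀ F : Polynomial ℂ, (LaurentPolynomial.C (F.comp u) : VV) ∈ R := by
    intro F
    induction F using Polynomial.induction_on with
    | C a => rw [Polynomial.C_comp]; exact R.algebraMap_mem a
    | add p q hp hq => rw [Polynomial.add_comp, map_add]; exact R.add_mem hp hq
    | monomial n a ih =>
      rw [pow_succ, ← mul_assoc, Polynomial.mul_comp, Polynomial.X_comp, map_mul]
      exact R.mul_mem ih huR
  have hRK : ∀ r ∈ R, r ∈ UU u I 0 := by
    intro r hr
    rw [mem_UU]
    intro F
    rw [pow_zero, one_mul, Lam_apply]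
    have h1 := hmom (LaurentPolynomial.C (F.comp u) * r) (R.mul_mem (hcompR F) hr) _ huR
    have h2 : I (LaurentPolynomial.C (F.comp u) * r * MV.D dP c (LaurentPolynomial.C u)) = 0 := h1
    have e : (LaurentPolynomial.C (F.comp u * Polynomial.derivative u) : VV) * r
        = LaurentPolynomial.C (F.comp u) * r * MV.D dP c (LaurentPolynomial.C u) := by
      have e1 : dP u = Polynomial.derivative u := rfl
      rw [D_C, e1, map_mul LaurentPolynomial.C]
      exact mul_right_comm _ _ _
    rw [← h2, ← e]
  -- germs
  set m0 := u.rootMultiplicity 0 with hm0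
  set m1 := u.rootMultiplicity (T : ℂ) with hm1
  have hm0p : 0 < m0 := (Polynomial.rootMultiplicity_pos hu0').2 hs0
  have hm1p : 0 < m1 := (Polynomial.rootMultiplicity_pos hu0').2 hs1
  obtain ⟨β0, hβ0, hβ0u⟩ := germ u hu0' 0 hs0 m1 hm1p
  obtain ⟨β1, hβ1, hβ1u⟩ := germ u hu0' T hs1 m0 hm0p
  rw [← hm0] at hβ0u
  rw [← hm1, mul_comm] at hβ1u
  set m := m0 * m1 with hmdef
  have hmp : 0 < m := Nat.mul_pos hm0p hm1p
  obtain ⟨E0, hE0, hE0'⟩ := expE (c • β0) (by simp [hβ0])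
  obtain ⟨E1, hE1, hE1'⟩ := expE (c • β1) (by simp [hβ1])
  set φ0 := gh 0 β0 E0 with hφ0
  set φ1 := gh T β1 E1 with hφ1
  have hunit : ∀ x : ℝ, Complex.exp (c * x) = 1 → evA c x = lft (Polynomial.aeval (x : ℂ)) (Units.mk0 1 one_ne_zero) := by
    intro x hx
    rw [evA]
    congr 1
    ext; simp [expu, hx]
  have hcc0 : ∀ v, constantCoeff (φ0 v) = evA c 0 v := by
    intro v
    rw [hφ0, gh_cc 0 1 one_ne_zero β0 E0 hβ0 hE0, hunit 0 (by simp)]; simp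
  have hcc1 : ∀ v, constantCoeff (φ1 v) = evA c T v := by
    intro v
    rw [hφ1, gh_cc T 1 one_ne_zero β1 E1 hβ1 hE1, hunit T hcT]
  have hφu0 : φ0 (LaurentPolynomial.C u) = X ^ m := by rw [hφ0, gh, lft_C]; exact hβ0u
  have hφu1 : φ1 (LaurentPolynomial.C u) = X ^ m := by rw [hφ1, gh, lft_C]; exact hβ1u
  have hZ : ∀ k, ∀ v ∈ UU u I 0, ZZ m k ((φ1.toLinearMap - φ0.toLinearMap) v) := by
    intro k
    apply coeff_vanish c u η Δ hΔ (UU u I 0)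
      (UU_Th c u η Δ hηΔ I (evA c 0) (evA c T) hI he0 he1 0) _ m hmp
    · intro v
      simp only [LinearMap.sub_apply, AlgHom.toLinearMap_apply]
      rw [smul_sub, hφ0, hφ1, gh_Th c 0 u η Δ hηΔ β0 E0 hE0' m hmp hβ0u,
        gh_Th c T u η Δ hηΔ β1 E1 hE1' m hmp hβ1u, map_sub]
      ring
    · intro v
      simp only [LinearMap.sub_apply, AlgHom.toLinearMap_apply]
      rw [map_mul, map_mul, hφu0, hφu1]; ring
    · intro v hv
      simp only [LinearMap.sub_apply, AlgHom.toLinearMap_apply]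
      rw [map_sub, hcc0, hcc1, mainA2 c u η Δ hηΔ hΔ hu I _ _ hI he0 he1 heη0 heη1 v hv, sub_self]
    · exact mainA3 c u η Δ hηΔ hΔ hu I _ _ hI he0 he1
  -- rotation
  obtain ⟨ω, hω⟩ : ∃ ω : ℂ, IsPrimitiveRoot ω m := ⟨_, Complex.isPrimitiveRoot_exp m hmp.ne'⟩
  obtain ⟨ζ, hζ⟩ : ∃ ζ : ℂ, ∀ r ∈ R, φ0 r = rescale ζ (φ1 r) := by
    have := indep (G := R) (L := ℂ⟦X⟧) (ι := Fin m)
      (fun i => (rescale (ω ^ (i : ℕ))).toMonoidHom.comp (φ0.toRingHom.toMonoidHom.comp R.val.toRingHom.toMonoidHom))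
      (fun i => (rescale (ω ^ (i : ℕ))).toMonoidHom.comp (φ1.toRingHom.toMonoidHom.comp R.val.toRingHom.toMonoidHom))
      (by
        rintro ⟨r, hr⟩
        have h1 := sum_rescale m ω hω (φ1 r - φ0 r) (fun k => hZ k r (hRK r hr) k le_rfl)
        simp only [map_sub, Finset.sum_sub_distrib] at h1
        exact (sub_eq_zero.1 h1).symm) ⟨0, hmp⟩
    obtain ⟨j, hj⟩ := this
    refine ⟨ω ^ (j : ℕ), fun r hr => ?_⟩
    have h1 := DFunLike.congr_fun hj ⟨r, hr⟩
    have h2 : rescale (ω ^ 0) (φ0 r) = rescale (ω ^ (j : ℕ)) (φ1 r) := h1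
    rw [pow_zero] at h2
    simpa using h2
  set φ1' : VV →ₐ[ℂ] ℂ⟦X⟧ := (rescaleAlgHom ζ).comp φ1 with hφ1'
  have hφ1'a : ∀ v, φ1' v = rescale ζ (φ1 v) := by
    intro v
    rw [hφ1', AlgHom.comp_apply, ← coe_rescaleAlgHom]; rfl
  have hw0 : ∀ v, derivative ℂ (φ0 v) = φ0 (MV.D dP c v) * derivative ℂ β0 := gh_chain c 0 β0 E0 hE0'
  have hw1 : ∀ v, derivative ℂ (φ1' v) = φ1' (MV.D dP c v) * (rescale ζ (derivative ℂ β1) * algebraMap ℂ ℂ⟦X⟧ ζ) := by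
    intro v
    rw [hφ1'a, hφ1'a, deriv_rescale, gh_chain c T β1 E1 hE1', map_mul]; ring
  have hβ0n : derivative ℂ β0 ≠ 0 := by
    intro h
    have h1 := congrArg (derivative ℂ) hβ0u
    rw [d_aeval, map_add, h] at h1
    simp only [Derivation.map_algebraMap, add_zero, mul_zero] at h1
    rw [Derivation.leibniz_pow] at h1
    simp at h1
    omega
  have hinj : Function.Injective φ0 := by
    rw [injective_iff_map_eq_zero]
    intro v hv
    refine inj_aux c hc (LinearMap.ker φ0.toLinearMap) ?_ ?_ (mu v) v hv le_rfl
    · intro v hv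
      have hv' : φ0 v = 0 := hv
      have := hw0 v
      rw [hv', map_zero] at this
      exact (mul_eq_zero.1 this.symm).resolve_right hβ0n
    · intro a j h
      have h1 : φ0 (LaurentPolynomial.C (Polynomial.C a) * LaurentPolynomial.T j) = 0 := h
      rw [map_mul, hφ0, gh, lft_T, lft_C, Polynomial.aeval_C] at h1
      have h2 := (mul_eq_zero.1 h1).resolve_right (Units.ne_zero _)
      exact (map_eq_zero_iff _ (FaithfulSMul.algebraMap_injective ℂ ℂ⟦X⟧)).1 h2
  have hdk : ∀ f : ℂ⟦X⟧, derivative ℂ f = 0 → ∃ κ : ℂ, f = algebraMap ℂ ℂ⟦X⟧ κ := by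
    intro f hf
    refine ⟨constantCoeff f, ?_⟩
    apply derivative.ext
    · rw [hf]; simp
    · simp [PowerSeries.algebraMap_apply]
  have hev1 : ∀ F, φ0 F = φ1' F → evA c T F = evA c 0 F := by
    intro F hF
    have := congrArg constantCoeff hF
    rw [hcc0, hφ1'a, ← coeff_zero_eq_constantCoeff_apply, coeff_rescale, pow_zero, one_mul, coeff_zero_eq_constantCoeff_apply, hcc1] at this
    exact this.symm
  have norm0 : ∀ F w : VV, MV.D dP c F = w → MV.D dP c (F - algebraMap ℂ VV (evA c 0 F)) = w ∧
      evA c 0 (F - algebraMap ℂ VV (evA c 0 F)) = 0 := by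
    intro F w h
    rw [map_sub, D_algebraMap, map_sub, AlgHom.commutes, h]; simp
  have hwords := words_gen (MV.D dP c) (evA c) T hT n a (evA_der c) G ha R hGR φ0 φ1' hinj
    (fun r hr => by rw [hζ r hr, hφ1'a]) (derivative ℂ) hdk _ _ hw0 hw1
  by_cases hcase : ∃ i g, G i = iota g ∧ ∀ a, iota g ≠ algebraMap ℂ VV a
  · obtain ⟨i, g, hig, hns⟩ := hcase
    refine hwords (fun _ => True) ?_ trivial ?_ hev1
    · intro F _
      induction F using LaurentPolynomial.induction_on' with
      | add p q hp hq => exact hp.add hq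
      | C_mul_T j p => exact (alg_C R u huR hu p).mul (alg_T R g (hig ▸ hGR i) hns j)
    · intro F i _ _
      obtain ⟨F', hF'⟩ := D_surj c (MV.D dP c (G i) * F)
      exact ⟨_, trivial, norm0 F' _ hF'⟩
  · push Not at hcase
    have hall : ∀ i, ∃ p, G i = LaurentPolynomial.C p := by
      intro i
      rcases hform i with h | ⟨g, hg⟩
      · exact h
      · obtain ⟨a, ha⟩ := hcase i g hg
        exact ⟨Polynomial.C a, by rw [hg, ha]; rfl⟩
    refine hwords (fun F => ∃ p, F = LaurentPolynomial.C p) ?_ ⟨1, by simp⟩ ?_ hev1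
    · rintro F ⟨p, rfl⟩; exact alg_C R u huR hu p
    · rintro F i ⟨p, rfl⟩ _
      obtain ⟨q, hq⟩ := hall i
      obtain ⟨s, hs⟩ := ode_poly 0 _ (Polynomial.derivative q * p) le_rfl
      rw [zero_smul, add_zero] at hs
      have hs' : MV.D dP c (LaurentPolynomial.C s) = MV.D dP c (G i) * LaurentPolynomial.C p := by
        rw [hq, D_C, D_C, ← map_mul]; exact congrArg _ hs
      refine ⟨_, ?_, norm0 _ _ hs'⟩
      refine ⟨s - Polynomial.C (evA c 0 (LaurentPolynomial.C s)), ?_⟩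
      rw [map_sub]; rfl

end A
end MV

namespace MV
open LaurentPolynomial

section L

/-- Laurent series -/
abbrev LL := HahnSeries ℤ ℂ

instance instLLalg : Algebra ℂ LL := HahnSeries.instAlgebra

/-- weight map on Laurent series -/
def wt (f : ℤ → ℂ) : LL →ₗ[ℂ] LL where
  toFun x := ⟨fun n => f n * x.coeff n, x.isPWO_support.mono (by
    intro n hn h
    simp only [Function.mem_support] at hn
    exact hn (by rw [h, mul_zero]))⟩
  map_add' x y := by ext n; simp [mul_add]
  map_smul' a x := by ext n; simp; ring

lemma wt_coeff (f : ℤ → ℂ) (x : LL) (n : ℤ) : (wt f x).coeff n = f n * x.coeff n := rfl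

lemma wt_supp (f : ℤ → ℂ) (x : LL) : (wt f x).support ⊆ x.support := by
  intro n hn h
  exact hn (by rw [wt_coeff, h, mul_zero])

lemma alg_coeff (a : ℂ) (n : ℤ) : (algebraMap ℂ LL a).coeff n = if n = 0 then a else 0 := by
  rw [HahnSeries.algebraMap_apply]
  simp [HahnSeries.C_apply, HahnSeries.coeff_single]

/-- Euler derivation -/
def Eu : Derivation ℂ LL LL := Derivation.mk' (wt fun n => (n : ℂ)) (by
  intro x y
  ext n
  simp only [smul_eq_mul, HahnSeries.coeff_add]
  rw [wt_coeff, HahnSeries.coeff_mul_right' y.isPWO_support (wt_supp _ y), mul_comm y,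
    HahnSeries.coeff_mul_left' x.isPWO_support (wt_supp _ x), HahnSeries.coeff_mul, Finset.mul_sum,
    ← Finset.sum_add_distrib]
  refine Finset.sum_congr rfl fun ij hij => ?_
  have : ij.1 + ij.2 = n := by simpa using (Finset.mem_antidiagonal.1 hij).2.2
  rw [wt_coeff, wt_coeff, ← this]; push_cast; ring)

lemma Eu_coeff (x : LL) (n : ℤ) : (Eu x).coeff n = n * x.coeff n := rfl

lemma Eu_ker (x : LL) (h : Eu x = 0) : ∃ κ : ℂ, x = algebraMap ℂ LL κ := by
  refine ⟨x.coeff 0, ?_⟩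
  ext n
  rw [alg_coeff]
  split_ifs with hn
  · rw [hn]
  · have := congrArg (fun y : LL => y.coeff n) h
    simp only [Eu_coeff, HahnSeries.coeff_zero] at this
    exact (mul_eq_zero.1 this).resolve_left (by exact_mod_cast hn)

/-- rotation -/
def rot (ζ : ℂ) (hζ : ζ ≠ 0) : LL →ₐ[ℂ] LL := AlgHom.ofLinearMap (wt fun n => ζ ^ n) (by
    ext n
    have := alg_coeff 1 n
    rw [map_one] at this
    rw [wt_coeff, this]
    split_ifs with h
    · rw [h]; simp
    · simp) (by
  intro x y
  ext n
  have hy : y.support ⊆ (wt (fun n => ζ ^ n) y).support := by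
    intro k hk h
    rw [wt_coeff] at h
    exact hk ((mul_eq_zero.1 h).resolve_left (zpow_ne_zero _ hζ))
  rw [wt_coeff, HahnSeries.coeff_mul_right' (wt (fun n => ζ ^ n) y).isPWO_support hy,
    HahnSeries.coeff_mul_left' (x.isPWO_support) (wt_supp _ x), Finset.mul_sum]
  refine Finset.sum_congr rfl fun ij hij => ?_
  have : ij.1 + ij.2 = n := by simpa using (Finset.mem_antidiagonal.1 hij).2.2
  rw [wt_coeff, wt_coeff, ← this, zpow_add₀ hζ]; ring)

lemma rot_coeff (ζ : ℂ) (hζ : ζ ≠ 0) (x : LL) (n : ℤ) : (rot ζ hζ x).coeff n = ζ ^ n * x.coeff n := rfl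

lemma rot_Eu (ζ : ℂ) (hζ : ζ ≠ 0) (x : LL) : Eu (rot ζ hζ x) = rot ζ hζ (Eu x) := by
  ext n; simp only [Eu_coeff, rot_coeff]; ring

lemma rot_inj (ζ : ℂ) (hζ : ζ ≠ 0) : Function.Injective (rot ζ hζ) := by
  rw [injective_iff_map_eq_zero]
  intro x hx
  ext n
  have := congrArg (fun y : LL => y.coeff n) hx
  simp only [rot_coeff, HahnSeries.coeff_zero] at this
  simpa using (mul_eq_zero.1 this).resolve_left (zpow_ne_zero _ hζ)

/-- embedding of power series -/
abbrev oP : PowerSeries ℂ →+* LL := HahnSeries.ofPowerSeries ℤ ℂ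

/-- parametrisation of a punctured disc of order `r` with logarithmic derivative `w` -/
structure Pm (r : ℤ) where
  β : LLˣ
  w : LL
  hw : Eu (β : LL) = β * w
  hw0 : w.coeff 0 = r

/-- the pullback -/
def Pm.ψ {r : ℤ} (P : Pm r) : ℂ[T;T⁻¹] →ₐ[ℂ] LL := lft (Algebra.ofId ℂ LL) P.β

def Pm.inv {r : ℤ} (P : Pm r) : Pm (-r) where
  β := P.β⁻¹
  w := - P.w
  hw := by
    have h : Eu ((P.β : LL) * (P.β⁻¹ : LLˣ)) = 0 := by simp
    rw [Derivation.leibniz, P.hw, smul_eq_mul, smul_eq_mul] at h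
    have h2 : (P.β : LL) * (P.β⁻¹ : LLˣ) = 1 := by simp
    apply P.β.isUnit.mul_left_cancel
    linear_combination h
  hw0 := by simp [P.hw0]

lemma Pm.inv_ψ {r : ℤ} (P : Pm r) (v : ℂ[T;T⁻¹]) : P.inv.ψ v = P.ψ (invert v) := by
  induction v using LaurentPolynomial.induction_on' with
  | add p q hp hq => simp only [map_add, hp, hq]
  | C_mul_T j p =>
    rw [map_mul, map_mul, map_mul, invert_C, invert_T]
    simp only [Pm.ψ, Pm.inv, lft_C, lft_T]
    simp

/-- the Euler derivation times `c` on Laurent polynomials -/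
abbrev DL (c : ℂ) : ℂ[T;T⁻¹] →ₗ[ℂ] ℂ[T;T⁻¹] := D (0 : Derivation ℂ ℂ ℂ) c

lemma Pm.chain {r : ℤ} (P : Pm r) (v : ℂ[T;T⁻¹]) : Eu (P.ψ v) = P.ψ (DL 1 v) * P.w := by
  apply chain_rule
  · intro p
    rw [Pm.ψ, lft_C]
    simp [Algebra.ofId_apply]
  · simp [Pm.ψ, lft_T, P.hw]

lemma Pm.res {r : ℤ} (P : Pm r) (v : ℂ[T;T⁻¹]) : (P.ψ v * P.w).coeff 0 = r * v.coeff 0 := by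
  induction v using LaurentPolynomial.induction_on' with
  | add p q hp hq => rw [map_add, add_mul, HahnSeries.coeff_add, hp, hq, AddMonoidAlgebra.coeff_add, Finsupp.add_apply]; ring
  | C_mul_T j p =>
    rw [coeff_CT]
    have h0 := congrArg (fun y : LL => y.coeff 0) (P.chain (C p * T j))
    simp only [Eu_coeff] at h0
    rw [D_CT] at h0
    have hC : ∀ q, P.ψ (C q) = algebraMap ℂ LL q := fun q => by rw [Pm.ψ, lft_C]; rfl
    split_ifs with hj
    · subst hj
      rw [T_zero, mul_one, hC, ← Algebra.smul_def, HahnSeries.coeff_smul, P.hw0, smul_eq_mul, mul_comm]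
    · have e : (0 : Derivation ℂ ℂ ℂ) p + (1 * (j : ℂ)) • p = j * p := by simp
      rw [e, map_mul P.ψ (C (_ * _)), hC, mul_assoc, ← Algebra.smul_def, HahnSeries.coeff_smul] at h0
      rw [map_mul, hC, mul_assoc, ← Algebra.smul_def, HahnSeries.coeff_smul, mul_zero]
      rw [Int.cast_zero, zero_mul, smul_eq_mul, mul_assoc] at h0
      exact (mul_eq_zero.1 h0.symm).resolve_left (by exact_mod_cast hj)

lemma alg_const (x : LL) (h : IsAlgebraic ℂ x) : ∃ κ : ℂ, x = algebraMap ℂ LL κ := by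
  have h1 := IsAlgClosed.degree_eq_one_of_irreducible ℂ (minpoly.irreducible h.isIntegral)
  obtain ⟨κ, hκ⟩ := minpoly.mem_range_of_degree_eq_one ℂ x h1
  exact ⟨κ, hκ.symm⟩

lemma Pm.aeval {r : ℤ} (P : Pm r) (f : Polynomial ℂ) :
    Polynomial.aeval (P.β : LL) f = P.ψ (Polynomial.toLaurent f) := by
  induction f using Polynomial.induction_on with
  | C a => rw [Polynomial.aeval_C, Polynomial.toLaurent_C, Pm.ψ, lft_C]; rfl
  | add p q hp hq => rw [map_add, hp, hq, ← map_add, ← map_add]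
  | monomial n a ih =>
    rw [pow_succ, ← mul_assoc, map_mul, ih, map_mul Polynomial.toLaurent _ Polynomial.X,
      map_mul P.ψ, Polynomial.toLaurent_X, Polynomial.aeval_X]
    congr 1
    rw [Pm.ψ, lft_T, zpow_one]

lemma Pm.inj {r : ℤ} (hr : r ≠ 0) (P : Pm r) : Function.Injective P.ψ := by
  rw [injective_iff_map_eq_zero]
  intro v hv
  obtain ⟨n, f, hf⟩ := LaurentPolynomial.exists_T_pow v
  have h1 : Polynomial.aeval (P.β : LL) f = 0 := by
    rw [P.aeval, hf, map_mul, hv, zero_mul]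
  have h2 : f = 0 := by
    by_contra hne
    obtain ⟨κ, hκ⟩ := alg_const (P.β : LL) ⟨f, hne, h1⟩
    have h3 := P.hw
    rw [hκ, Derivation.map_algebraMap, ← hκ] at h3
    have h4 : P.w = 0 := P.β.isUnit.mul_left_cancel (by rw [← h3, mul_zero])
    have h5 := P.hw0
    rw [h4, HahnSeries.coeff_zero] at h5
    exact hr (by exact_mod_cast h5.symm)
  rw [h2, map_zero] at hf
  have h3 : v * T n * T (-n) = 0 := by rw [← hf, zero_mul]
  rw [mul_assoc, ← T_add] at h3
  simpa using h3

lemma oP_coeff (f : PowerSeries ℂ) (k : ℕ) : (oP f).coeff (k : ℤ) = PowerSeries.coeff k f :=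
  HahnSeries.ofPowerSeries_apply_coeff f k

lemma oP_Eu (f : PowerSeries ℂ) : Eu (oP f) = oP (PowerSeries.X * PowerSeries.derivative ℂ f) := by
  ext n
  rw [Eu_coeff]
  rcases lt_or_ge n 0 with hn | hn
  · have : ∀ g : PowerSeries ℂ, (oP g).coeff n = 0 := by
      intro g
      have h := PowerSeries.coeff_coe (f := g) n
      rw [if_pos hn] at h
      exact h
    rw [this, this, mul_zero]
  · obtain ⟨k, rfl⟩ := Int.eq_ofNat_of_zero_le hn
    rw [oP_coeff, oP_coeff, coeff_Xd]; simp

lemma oP_alg (a : ℂ) : oP (algebraMap ℂ (PowerSeries ℂ) a) = algebraMap ℂ LL a := by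
  exact HahnSeries.ofPowerSeries_C a

lemma st_mul (r : ℕ) : (HahnSeries.single (r : ℤ) 1 : LL) * HahnSeries.single (-(r : ℤ)) 1 = 1 := by
  rw [HahnSeries.single_mul_single]; simp

lemma oP_inv (b : PowerSeries ℂ) (hb : PowerSeries.constantCoeff b ≠ 0) : oP b * oP b⁻¹ = 1 := by
  rw [← map_mul, PowerSeries.mul_inv_cancel b hb, map_one]

lemma Eu_single (r : ℕ) : Eu (HahnSeries.single (r : ℤ) 1 : LL) = (r : LL) * HahnSeries.single (r : ℤ) 1 := by
  rw [← nsmul_eq_mul]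
  ext j
  rw [Eu_coeff, HahnSeries.coeff_smul, HahnSeries.coeff_single]
  split_ifs with h
  · simp [h]
  · simp

/-- parametrisation from a power series -/
def mkPm (r : ℕ) (b : PowerSeries ℂ) (hb : PowerSeries.constantCoeff b ≠ 0) : Pm r where
  β := ⟨HahnSeries.single (r : ℤ) 1 * oP b, HahnSeries.single (-(r : ℤ)) 1 * oP b⁻¹,
    by linear_combination oP b * oP b⁻¹ * st_mul r + oP_inv b hb,
    by linear_combination oP b * oP b⁻¹ * st_mul r + oP_inv b hb⟩
  w := r + Eu (oP b) * oP b⁻¹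
  hw := by
    simp only
    rw [Derivation.leibniz, Eu_single, smul_eq_mul, smul_eq_mul]
    linear_combination -(HahnSeries.single (r : ℤ) 1 : LL) * Eu (oP b) * oP_inv b hb
  hw0 := by
    rw [HahnSeries.coeff_add, oP_Eu, ← map_mul]
    have h1 := oP_coeff (PowerSeries.X * PowerSeries.derivative ℂ b * b⁻¹) 0
    rw [Nat.cast_zero] at h1
    rw [h1]
    have h2 := alg_coeff (r : ℂ) 0
    rw [map_natCast] at h2
    rw [h2]
    simp

lemma mkPm_β (r : ℕ) (b : PowerSeries ℂ) (hb : PowerSeries.constantCoeff b ≠ 0) :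
    ((mkPm r b hb).β : LL) = HahnSeries.single (r : ℤ) 1 * oP b := rfl

lemma oP_aeval (y : PowerSeries ℂ) (k : Polynomial ℂ) : Polynomial.aeval (oP y) k = oP (Polynomial.aeval y k) := by
  induction k using Polynomial.induction_on' with
  | add p q hp hq => rw [map_add, hp, hq, map_add, map_add]
  | monomial n a => rw [Polynomial.aeval_monomial, Polynomial.aeval_monomial, map_mul, map_pow, oP_alg]

lemma exists_Pm (u : ℂ[T;T⁻¹]) (n r : ℕ) (hn : 0 < n) (hr : 0 < r) (k : Polynomial ℂ) (hk : k.eval 0 ≠ 0)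
    (hu : Polynomial.toLaurent k = u * T n) :
    ∃ P : Pm r, P.ψ u = HahnSeries.single (-(n * r : ℤ)) 1 := by
  obtain ⟨b, hb, hbk⟩ := solveL k hk n r hn hr
  refine ⟨mkPm r b hb, ?_⟩
  have hX : oP (PowerSeries.X ^ r) = (HahnSeries.single (r : ℤ) 1 : LL) := by
    rw [HahnSeries.ofPowerSeries_X_pow]
  have hβ := mkPm_β r b hb
  set P := mkPm r b hb
  have h1 := P.aeval k
  have h2 : Polynomial.aeval (P.β : LL) k = oP (Polynomial.aeval (PowerSeries.X ^ r * b) k) := by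
    rw [hβ, ← oP_aeval, map_mul, hX]
  rw [h2, hbk, hu, map_mul] at h1
  have h3 : P.ψ (T n) = HahnSeries.single (r : ℤ) 1 ^ n * oP b ^ n := by
    rw [Pm.ψ, lft_T, zpow_natCast, Units.val_pow_eq_pow_val, ← mul_pow, hβ]
  rw [h3, map_pow] at h1
  have h4 : (HahnSeries.single (r : ℤ) 1 : LL) ^ n * HahnSeries.single (-(n * r : ℤ)) 1 = 1 := by
    rw [HahnSeries.single_pow, HahnSeries.single_mul_single]; simp
  have h5 : oP b ^ n * oP b⁻¹ ^ n = 1 := by rw [← mul_pow, oP_inv b hb, one_pow]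
  calc P.ψ u = P.ψ u * (HahnSeries.single (r : ℤ) 1 ^ n * oP b ^ n) * (oP b⁻¹ ^ n * HahnSeries.single (-(n * r : ℤ)) 1) := by
        linear_combination (- P.ψ u) * (oP b ^ n * oP b⁻¹ ^ n) * h4 - P.ψ u * h5
    _ = _ := by rw [← h1, ← mul_assoc, h5, one_mul]

end L
end MV

namespace MV
open LaurentPolynomial

section L

lemma coeff_mulT (v : ℂ[T;T⁻¹]) (n j : ℤ) : (v * T n).coeff j = v.coeff (j - n) := by
  induction v using LaurentPolynomial.induction_on' with
  | add p q hp hq => simp only [add_mul, AddMonoidAlgebra.coeff_add, Finsupp.add_apply, hp, hq]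
  | C_mul_T k p =>
    rw [mul_assoc, ← T_add, coeff_CT, coeff_CT]
    congr 1
    rw [eq_sub_iff_add_eq]

lemma coeff_toLaurent_neg (f : Polynomial ℂ) (j : ℤ) (hj : j < 0) : (Polynomial.toLaurent f).coeff j = 0 := by
  induction f using Polynomial.induction_on' with
  | add p q hp hq => rw [map_add, AddMonoidAlgebra.coeff_add, Finsupp.add_apply, hp, hq, add_zero]
  | monomial n a =>
    rw [← Polynomial.C_mul_X_pow_eq_monomial, Polynomial.toLaurent_C_mul_X_pow, coeff_CT, if_neg]
    omega

lemma pole (u : ℂ[T;T⁻¹]) (j : ℤ) (hj : j < 0) (hu : u.coeff j ≠ 0) :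
    ∃ (n : ℕ) (k : Polynomial ℂ), 0 < n ∧ k.eval 0 ≠ 0 ∧ Polynomial.toLaurent k = u * T n := by
  obtain ⟨N, f, hf⟩ := LaurentPolynomial.exists_T_pow u
  have hf0 : f ≠ 0 := by
    rintro rfl
    rw [map_zero] at hf
    have h1 := coeff_mulT u N (j + N)
    rw [← hf] at h1
    simp at h1
    exact hu h1.symm
  obtain ⟨k, hk, hkX⟩ := Polynomial.exists_eq_pow_rootMultiplicity_mul_and_not_dvd f hf0 0
  rw [map_zero, sub_zero] at hk hkX
  set e := Polynomial.rootMultiplicity 0 f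
  have h1 : Polynomial.toLaurent k = u * T ((N : ℤ) - e) := by
    rw [hk, map_mul, map_pow, Polynomial.toLaurent_X, T_pow] at hf
    have h2 := congrArg (fun x => x * T (-(e : ℤ))) hf
    simp only [mul_assoc] at h2
    rw [← T_add, mul_comm, mul_assoc, ← T_add] at h2
    simpa [sub_eq_add_neg] using h2
  have h3 : 0 < (N : ℤ) - e := by
    by_contra hcon
    have h4 := coeff_mulT u ((N : ℤ) - e) (j + ((N : ℤ) - e))
    rw [← h1, coeff_toLaurent_neg k _ (by omega), add_sub_cancel_right] at h4
    exact hu h4.symm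
  refine ⟨N - e, k, by omega, ?_, ?_⟩
  · intro h
    apply hkX
    rw [← sub_zero Polynomial.X, ← map_zero Polynomial.C, Polynomial.dvd_iff_isRoot]
    exact h
  · rw [h1]; congr 2; omega

lemma sum_rootz (m : ℕ) (ω : ℂ) (hω : IsPrimitiveRoot ω m) (n : ℤ) (hn : ¬ (m : ℤ) ∣ n) :
    ∑ i : Fin m, (ω ^ (i : ℕ)) ^ n = 0 := by
  have h1 : ω ^ n ≠ 1 := fun h => hn ((hω.zpow_eq_one_iff_dvd n).1 h)
  have h2 := mul_geom_sum (ω ^ n) m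
  have e : (ω ^ n) ^ m = 1 := by
    rw [← zpow_natCast, ← zpow_mul, mul_comm, zpow_mul, zpow_natCast, hω.pow_eq_one, one_zpow]
  rw [e, sub_self] at h2
  have h3 := (mul_eq_zero.1 h2).resolve_left (sub_ne_zero.2 h1)
  rw [Finset.sum_range] at h3
  rw [← h3]
  refine Finset.sum_congr rfl fun i _ => ?_
  rw [← zpow_natCast, ← zpow_natCast, ← zpow_mul, ← zpow_mul, mul_comm]

/-- the element `t^{-m}` -/
abbrev tm (m : ℕ) : LL := HahnSeries.single (-(m : ℤ)) 1

lemma tm_pow (m k : ℕ) : tm m ^ k = HahnSeries.single (-(m * k : ℤ)) 1 := by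
  rw [HahnSeries.single_pow]; simp [mul_comm]

lemma fin_bd (m : ℕ) (hm : 0 < m) (y : LL) : ∃ N : ℕ, ∀ j : ℕ, N ≤ j → y.coeff (-(m * j : ℤ)) = 0 := by
  obtain ⟨o, ho⟩ : ∃ o : ℤ, ∀ i, i < o → y.coeff i = 0 := ⟨y.order, fun i hi => HahnSeries.coeff_eq_zero_of_lt_order hi⟩
  refine ⟨(-o).toNat + 1, fun j hj => ho _ ?_⟩
  have h1 : (1 : ℤ) ≤ m := by exact_mod_cast hm
  have h2 : (m : ℤ) * j ≥ j := by nlinarith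
  omega

lemma fin_sum (m : ℕ) (hm : 0 < m) (y : LL) (hy0 : ∀ n : ℤ, ¬ (m : ℤ) ∣ n → y.coeff n = 0)
    (hy1 : ∀ k : ℕ, y.coeff (m * (k + 1)) = 0) (N : ℕ) (hN : ∀ j : ℕ, N ≤ j → y.coeff (-(m * j : ℤ)) = 0) :
    y = ∑ j ∈ Finset.range N, (HahnSeries.single (-(m * j : ℤ)) (y.coeff (-(m * j : ℤ))) : LL) := by
  ext n
  have hS : (∑ j ∈ Finset.range N, (HahnSeries.single (-(m * j : ℤ)) (y.coeff (-(m * j : ℤ))) : LL)).coeff n = ∑ j ∈ Finset.range N, ((HahnSeries.single (-(m * j : ℤ)) (y.coeff (-(m * j : ℤ))) : LL)).coeff n := HahnSeries.coeff_sum _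
  rw [hS]
  simp only [HahnSeries.coeff_single]
  by_cases hn : (m : ℤ) ∣ n
  · obtain ⟨k, rfl⟩ := hn
    have hm' : (m : ℤ) ≠ 0 := by exact_mod_cast hm.ne'
    rcases lt_or_ge 0 k with hk | hk
    · obtain ⟨k', rfl⟩ : ∃ k' : ℕ, k = k' + 1 := ⟨(k - 1).toNat, by omega⟩
      rw [hy1]
      symm
      apply Finset.sum_eq_zero
      intro j _
      rw [if_neg]
      intro h
      rw [← mul_neg] at h
      have := mul_left_cancel₀ hm' h
      omega
    · obtain ⟨j, rfl⟩ : ∃ j : ℕ, k = -(j : ℤ) := ⟨(-k).toNat, by omega⟩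
      by_cases hj : j < N
      · rw [Finset.sum_eq_single_of_mem j (Finset.mem_range.2 hj)]
        · rw [mul_neg, if_pos rfl]
        · intro i _ hij
          rw [if_neg]
          intro h
          rw [← mul_neg] at h
          have := mul_left_cancel₀ hm' h
          omega
      · rw [mul_neg, hN j (by omega), Finset.sum_eq_zero]
        intro i hi
        rw [if_neg]
        intro h
        rw [neg_inj] at h
        have := mul_left_cancel₀ hm' h
        rw [Finset.mem_range] at hi
        omega
  · rw [hy0 n hn, Finset.sum_eq_zero]
    intro j _
    rw [if_neg]
    rintro rfl
    exact hn ((dvd_mul_right _ _).neg_right)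


lemma single_mem (m j : ℕ) (b : ℂ) : (HahnSeries.single (-(m * j : ℤ)) b : LL) ∈ Algebra.adjoin ℂ {tm m} := by
  have e : (HahnSeries.single (-(m * j : ℤ)) b : LL) = algebraMap ℂ LL b * tm m ^ j := by
    rw [tm_pow, HahnSeries.algebraMap_apply]
    simp [HahnSeries.C_apply, HahnSeries.single_mul_single]
  rw [e]
  exact Subalgebra.mul_mem _ (Subalgebra.algebraMap_mem _ _) (Subalgebra.pow_mem _ (Algebra.self_mem_adjoin_singleton _ _) _)

lemma fin_mem (m : ℕ) (hm : 0 < m) (y : LL) (hy0 : ∀ n : ℤ, ¬ (m : ℤ) ∣ n → y.coeff n = 0)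
    (hy1 : ∀ k : ℕ, y.coeff (m * (k + 1)) = 0) : y ∈ Algebra.adjoin ℂ {tm m} := by
  obtain ⟨N, hN⟩ := fin_bd m hm y
  rw [fin_sum m hm y hy0 hy1 N hN]
  exact Subalgebra.sum_mem _ fun j _ => single_mem m j _

lemma trace_mem (m : ℕ) (hm : 0 < m) (ω : ℂ) (hω : IsPrimitiveRoot ω m) (hω0 : ∀ i : ℕ, ω ^ i ≠ 0) (x : LL)
    (hx : ∀ k : ℕ, x.coeff (m * (k + 1)) = 0) :
    ∑ i : Fin m, rot (ω ^ (i : ℕ)) (hω0 i) x ∈ Algebra.adjoin ℂ {tm m} := by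
  set y := ∑ i : Fin m, rot (ω ^ (i : ℕ)) (hω0 i) x with hy
  have hyc : ∀ n : ℤ, y.coeff n = (∑ i : Fin m, (ω ^ (i : ℕ)) ^ n) * x.coeff n := by
    intro n
    rw [hy, Finset.sum_mul, HahnSeries.coeff_sum]
    rfl
  have hy0 : ∀ n : ℤ, ¬ (m : ℤ) ∣ n → y.coeff n = 0 := by
    intro n hn
    rw [hyc, sum_rootz m ω hω n hn, zero_mul]
  have hy1 : ∀ k : ℕ, y.coeff (m * (k + 1)) = 0 := by
    intro k; rw [hyc, hx, mul_zero]
  exact fin_mem m hm y hy0 hy1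

lemma newton (A : Subalgebra ℂ LL) (m : ℕ) (f : Fin m → LL) (h : ∀ k, ∑ i, f i ^ k ∈ A) (k : ℕ) :
    MvPolynomial.aeval f (MvPolynomial.esymm (Fin m) ℂ k) ∈ A := by
  induction k using Nat.strong_induction_on with
  | _ k ih =>
    rcases Nat.eq_zero_or_pos k with rfl | hk
    · simp
    have h1 := congrArg (MvPolynomial.aeval f) (MvPolynomial.mul_esymm_eq_sum (Fin m) ℂ k)
    have h2 : (k : LL) * MvPolynomial.aeval f (MvPolynomial.esymm (Fin m) ℂ k) ∈ A := by
      rw [map_mul, map_natCast] at h1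
      rw [h1, map_mul, map_pow, map_neg, map_one, map_sum]
      refine A.mul_mem (A.pow_mem (A.neg_mem A.one_mem) _) (A.sum_mem ?_)
      intro a ha
      rw [Finset.mem_filter] at ha
      rw [map_mul, map_mul, map_pow, map_neg, map_one]
      refine A.mul_mem (A.mul_mem (A.pow_mem (A.neg_mem A.one_mem) _) (ih _ ha.2)) ?_
      rw [MvPolynomial.psum, map_sum]
      simpa using h a.2
    have h3 := A.smul_mem h2 (k : ℂ)⁻¹
    rw [← nsmul_eq_mul, ← Nat.cast_smul_eq_nsmul ℂ, smul_smul, inv_mul_cancel₀ (by exact_mod_cast hk.ne'), one_smul] at h3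
    exact h3

lemma vieta (m : ℕ) (f : Fin m → LL) (x : LL) : ∏ i, (x - f i) =
    ∑ j ∈ Finset.range (m + 1), (-1) ^ j * (MvPolynomial.aeval f (MvPolynomial.esymm (Fin m) ℂ j) * x ^ (m - j)) := by
  have h := congrArg (Polynomial.eval x) (Multiset.prod_X_sub_X_eq_sum_esymm (Finset.univ.val.map f))
  rw [Polynomial.eval_multiset_prod, Multiset.map_map, Multiset.map_map] at h
  simp only [MvPolynomial.aeval_esymm_eq_multiset_esymm]
  simpa [Polynomial.eval_finsetSum, List.prod_ofFn] using h

lemma coeff_L {r : ℤ} (P : Pm r) (u : ℂ[T;T⁻¹]) (m : ℕ) (hm : 0 < m) (hu : P.ψ u = tm m) (R : Subalgebra ℂ ℂ[T;T⁻¹])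
    (huR : u ∈ R) (hres : ∀ f ∈ R, ∀ g ∈ R, (f * DL 1 g).coeff 0 = 0) (f : ℂ[T;T⁻¹]) (hf : f ∈ R) (k : ℕ) :
    (P.ψ f).coeff (m * (k + 1)) = 0 := by
  have h1 := P.res (f * u ^ k * DL 1 u)
  rw [hres _ (R.mul_mem hf (R.pow_mem huR k)) u huR, mul_zero, map_mul, map_mul, map_pow, mul_assoc, ← P.chain, hu, tm_pow] at h1
  have h2 : Eu (tm m) = HahnSeries.single (-(m : ℤ)) (-(m : ℂ)) := by
    ext j
    rw [Eu_coeff, HahnSeries.coeff_single, HahnSeries.coeff_single]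
    split_ifs with h
    · simp [h]
    · simp
  rw [h2, HahnSeries.coeff_mul_single, HahnSeries.coeff_mul_single] at h1
  have h3 : (0 : ℤ) - -(m : ℤ) - -(m * k : ℤ) = m * (k + 1) := by ring
  rw [h3] at h1
  simpa [hm.ne'] using h1

lemma conj_L {r0 r1 : ℤ} (hr0 : r0 ≠ 0) (P0 : Pm r0) (P1 : Pm r1) (u : ℂ[T;T⁻¹]) (m : ℕ) (hm : 0 < m)
    (hu0 : P0.ψ u = tm m) (hu1 : P1.ψ u = tm m) (R : Subalgebra ℂ ℂ[T;T⁻¹])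
    (huR : u ∈ R) (hres : ∀ f ∈ R, ∀ g ∈ R, (f * DL 1 g).coeff 0 = 0) :
    ∃ (ζ : ℂ) (hζ : ζ ≠ 0), ∀ r ∈ R, rot ζ hζ (P0.ψ r) = P1.ψ r := by
  obtain ⟨ω, hω⟩ : ∃ ω : ℂ, IsPrimitiveRoot ω m := ⟨_, Complex.isPrimitiveRoot_exp m hm.ne'⟩
  have hω0 : ∀ i : ℕ, ω ^ i ≠ 0 := fun i => pow_ne_zero _ (hω.ne_zero hm.ne')
  have key : ∀ y ∈ R, ∃ i : Fin m, rot (ω ^ (i : ℕ)) (hω0 i) (P0.ψ y) = P1.ψ y := by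
    intro y hy
    set f : Fin m → LL := fun i => rot (ω ^ (i : ℕ)) (hω0 i) (P0.ψ y) with hf
    have h1 : ∀ k, ∑ i, f i ^ k ∈ Algebra.adjoin ℂ {tm m} := by
      intro k
      have := trace_mem m hm ω hω hω0 (P0.ψ (y ^ k)) (coeff_L P0 u m hm hu0 R huR hres _ (R.pow_mem hy k))
      simpa only [map_pow] using this
    have h2 : ∀ j, ∃ q : Polynomial ℂ, Polynomial.aeval (tm m) q = MvPolynomial.aeval f (MvPolynomial.esymm (Fin m) ℂ j) := by
      intro j
      have := newton _ m f h1 j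
      rw [Algebra.adjoin_singleton_eq_range_aeval] at this
      exact this
    choose q hq using h2
    set W := ∑ j ∈ Finset.range (m + 1), (-1) ^ j * (Polynomial.aeval u (q j) * y ^ (m - j)) with hW
    have hψ : ∀ ψ : ℂ[T;T⁻¹] →ₐ[ℂ] LL, ψ u = tm m → ψ W = ∏ i, (ψ y - f i) := by
      intro ψ hψ
      rw [vieta, hW, map_sum]
      refine Finset.sum_congr rfl fun j _ => ?_
      rw [map_mul, map_mul, map_pow, map_pow, map_neg, map_one, ← Polynomial.aeval_algHom_apply, hψ, hq]
    have hW0 : W = 0 := by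
      apply P0.inj hr0
      rw [hψ _ hu0, map_zero]
      apply Finset.prod_eq_zero (Finset.mem_univ (⟨0, hm⟩ : Fin m))
      rw [sub_eq_zero, hf]
      ext n
      rw [rot_coeff]; simp
    have h3 := hψ _ hu1
    rw [hW0, map_zero] at h3
    obtain ⟨i, -, hi⟩ := Finset.prod_eq_zero_iff.1 h3.symm
    exact ⟨i, (sub_eq_zero.1 hi).symm⟩
  have := Subspace.exists_eq_top_of_iUnion_eq_univ (k := ℂ) (E := R) (ι := Fin m)
    (p := fun i => LinearMap.ker (((rot (ω ^ (i : ℕ)) (hω0 i)).toLinearMap ∘ₗ P0.ψ.toLinearMap - P1.ψ.toLinearMap) ∘ₗ R.val.toLinearMap)) (by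
      rw [Set.eq_univ_iff_forall]
      rintro ⟨y, hy⟩
      obtain ⟨i, hi⟩ := key y hy
      rw [Set.mem_iUnion]
      refine ⟨i, ?_⟩
      show rot (ω ^ (i : ℕ)) (hω0 i) (P0.ψ y) - P1.ψ y = 0
      rw [hi, sub_self])
  obtain ⟨i, hi⟩ := this
  refine ⟨_, hω0 i, fun r hr => ?_⟩
  have h1 : (⟨r, hr⟩ : R) ∈ (⊤ : Submodule ℂ R) := trivial
  rw [← hi] at h1
  have h2 : rot (ω ^ (i : ℕ)) (hω0 i) (P0.ψ r) - P1.ψ r = 0 := h1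
  exact sub_eq_zero.1 h2

end L
end MV

namespace MV
open LaurentPolynomial

section L

/-- evaluation of trigonometric polynomials -/
def evL (c : ℂ) (x : ℝ) : ℂ[T;T⁻¹] →ₐ[ℂ] ℂ := lft (AlgHom.id ℂ ℂ) (expu c x)

lemma evL_der (c : ℂ) (v : ℂ[T;T⁻¹]) (x : ℝ) : HasDerivAt (fun x => evL c x v) (evL c x (DL c v)) x := by
  apply ev_der 0 c (fun _ => AlgHom.id ℂ ℂ)
  intro p x
  simpa using hasDerivAt_const x p

lemma evL_CT (c : ℂ) (x : ℝ) (p : ℂ) (j : ℤ) : evL c x (C p * T j) = p * Complex.exp (c * j * x) := by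
  rw [map_mul, evL, lft_C, lft_T, expu_zpow]; rfl

lemma DL_coeff (c : ℂ) (v : ℂ[T;T⁻¹]) (j : ℤ) : (DL c v).coeff j = c * j * v.coeff j := by
  rw [coeff_D]; simp

lemma DL_CT (c p : ℂ) (j : ℤ) : DL c (C p * T j) = C (c * j * p) * T j := by
  rw [D_CT]; simp

lemma DL_one (c : ℂ) (v : ℂ[T;T⁻¹]) : DL c v = algebraMap ℂ _ c * DL 1 v := by
  rw [← Algebra.smul_def]
  induction v using LaurentPolynomial.induction_on' with
  | add p q hp hq => rw [map_add, map_add, smul_add, hp, hq]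
  | C_mul_T j p => rw [DL_CT, DL_CT, smul_CT, smul_eq_mul]; congr 2; ring

lemma DL_surj (c : ℂ) (hc : c ≠ 0) (v : ℂ[T;T⁻¹]) : ∃ F, DL c F = v - C (v.coeff 0) := by
  induction v using LaurentPolynomial.induction_on' with
  | add p q hp hq =>
    obtain ⟨f, hf⟩ := hp; obtain ⟨g, hg⟩ := hq
    refine ⟨f + g, ?_⟩
    rw [map_add, hf, hg, AddMonoidAlgebra.coeff_add, Finsupp.add_apply, map_add]; ring
  | C_mul_T j p =>
    rw [coeff_CT]
    split_ifs with h
    · exact ⟨0, by subst h; simp⟩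
    · refine ⟨C (p / (c * j)) * T j, ?_⟩
      have : c * j ≠ 0 := mul_ne_zero hc (by exact_mod_cast h)
      rw [DL_CT, mul_div_cancel₀ _ this]; simp

lemma evL_per (c : ℂ) (T : ℝ) (hcT : Complex.exp (c * T) = 1) (v : ℂ[T;T⁻¹]) : evL c T v = evL c 0 v := by
  have : expu c T = expu c 0 := by ext; simp [expu, hcT]
  rw [evL, evL, this]

lemma DL_norm (c : ℂ) (hc : c ≠ 0) (v : ℂ[T;T⁻¹]) (hv : v.coeff 0 = 0) : ∃ F, DL c F = v ∧ evL c 0 F = 0 := by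
  obtain ⟨F, hF⟩ := DL_surj c hc v
  rw [hv, map_zero, sub_zero] at hF
  exact ⟨F - algebraMap ℂ _ (evL c 0 F), by rw [map_sub, D_algebraMap, hF, sub_zero],
    by rw [map_sub, AlgHom.commutes]; simp⟩

lemma int_L (c : ℂ) (hc : c ≠ 0) (T : ℝ) (hcT : Complex.exp (c * T) = 1) (v : ℂ[T;T⁻¹]) :
    ∫ x in (0:ℝ)..T, evL c x v = T * v.coeff 0 := by
  obtain ⟨F, hF⟩ := DL_surj c hc v
  have h1 := ev_ftc (DL c) (evL c) (evL_der c) F 0 T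
  rw [evL_per c T hcT, sub_self, hF] at h1
  have hC : ∀ x, evL c x (C (v.coeff 0)) = v.coeff 0 := fun x => by rw [evL, lft_C]; rfl
  simp only [map_sub, hC] at h1
  rw [intervalIntegral.integral_sub ((ev_cont _ _ (evL_der c) v).intervalIntegrable _ _) (by simp)] at h1
  rw [sub_eq_zero.1 h1]; simp

lemma coeff_toLaurent_nat (f : Polynomial ℂ) (j : ℕ) : (Polynomial.toLaurent f).coeff (j : ℤ) = f.coeff j := by
  induction f using Polynomial.induction_on' with
  | add p q hp hq => rw [map_add, AddMonoidAlgebra.coeff_add, Finsupp.add_apply, hp, hq, Polynomial.coeff_add]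
  | monomial n a =>
    rw [← Polynomial.C_mul_X_pow_eq_monomial, Polynomial.toLaurent_C_mul_X_pow, coeff_CT]
    simp [eq_comm]

lemma exists_poly (v : ℂ[T;T⁻¹]) (hv : ∀ j < 0, v.coeff j = 0) : ∃ f, v = Polynomial.toLaurent f := by
  obtain ⟨N, f, hf⟩ := LaurentPolynomial.exists_T_pow v
  have : Polynomial.X ^ N ∣ f := by
    rw [Polynomial.X_pow_dvd_iff]
    intro d hd
    rw [← coeff_toLaurent_nat, hf, coeff_mulT]
    exact hv _ (by omega)
  obtain ⟨g, rfl⟩ := this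
  refine ⟨g, ?_⟩
  rw [map_mul, map_pow, Polynomial.toLaurent_X, T_pow] at hf
  have h2 := congrArg (fun x => x * T (-(N : ℤ))) hf
  simp only [mul_assoc] at h2
  rw [← T_add, mul_comm, mul_assoc, ← T_add] at h2
  simpa using h2.symm

lemma coeff_prod (A F : ℂ[T;T⁻¹]) (hA : ∀ j ≤ 0, A.coeff j = 0) (hF : ∀ j < 0, F.coeff j = 0) (j : ℤ) (hj : j ≤ 0) :
    (A * F).coeff j = 0 := by
  obtain ⟨p, hp⟩ := exists_poly (A * T (-1)) (fun j hj => by rw [coeff_mulT]; exact hA _ (by omega))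
  obtain ⟨f, hf⟩ := exists_poly F hF
  have h1 := coeff_toLaurent_neg (p * f) (j - 1) (by omega)
  rw [map_mul, ← hp, ← hf, mul_right_comm, coeff_mulT] at h1
  simpa using h1

lemma caseL_nonneg (T : ℝ) (hT : 0 < T) (n : ℕ) (a : Fin n → ℝ → ℂ) (c : ℂ) (hc : c ≠ 0)
    (hcT : Complex.exp (c * T) = 1) (G : Fin n → ℂ[T;T⁻¹])
    (ha : ∀ i, ∀ x ∈ Icc (0:ℝ) T, a i x = evL c x (DL c (G i)))
    (hG : ∀ i, ∀ j < 0, (G i).coeff j = 0) :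
    ∀ l : List (Fin n), l ≠ [] → iterInt T a l = 0 := by
  refine word_lemma (DL c) (evL c) T hT n a (evL_der c) G ha (fun F => ∀ j < 0, F.coeff j = 0) ?_ ?_
  · intro j hj
    have := coeff_CT (1 : ℂ) 0 j
    rw [if_neg (by omega), T_zero, map_one, mul_one] at this
    exact this
  · intro F i hF
    have h1 := coeff_prod (DL c (G i)) F (fun j hj => by
      rw [DL_coeff]
      rcases hj.lt_or_eq with h | h
      · rw [hG i j h, mul_zero]
      · rw [h]; simp) hF
    obtain ⟨F', hF', h0⟩ := DL_norm c hc _ (h1 0 le_rfl)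
    refine ⟨F', fun j hj => ?_, hF', h0, by rw [evL_per c T hcT, h0]⟩
    have h2 := h1 j hj.le
    rw [← hF', DL_coeff] at h2
    have : c * j ≠ 0 := mul_ne_zero hc (by exact_mod_cast hj.ne)
    exact (mul_eq_zero.1 h2).resolve_left this

lemma evL_inv (c : ℂ) (x : ℝ) (v : ℂ[T;T⁻¹]) : evL (-c) x (invert v) = evL c x v := by
  induction v using LaurentPolynomial.induction_on' with
  | add p q hp hq => simp only [map_add, hp, hq]
  | C_mul_T j p => rw [map_mul invert, invert_C, invert_T, evL_CT, evL_CT]; push_cast; ring_nf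

lemma DL_inv (c : ℂ) (v : ℂ[T;T⁻¹]) : DL (-c) (invert v) = invert (DL c v) := by
  induction v using LaurentPolynomial.induction_on' with
  | add p q hp hq => simp only [map_add, hp, hq]
  | C_mul_T j p =>
    rw [map_mul invert, invert_C, invert_T, DL_CT, DL_CT, map_mul invert, invert_C, invert_T]; push_cast; ring_nf

lemma coeff_inv (v : ℂ[T;T⁻¹]) (j : ℤ) : (invert v).coeff j = v.coeff (-j) := by
  simp

lemma caseL_nonpos (T : ℝ) (hT : 0 < T) (n : ℕ) (a : Fin n → ℝ → ℂ) (c : ℂ) (hc : c ≠ 0)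
    (hcT : Complex.exp (c * T) = 1) (G : Fin n → ℂ[T;T⁻¹])
    (ha : ∀ i, ∀ x ∈ Icc (0:ℝ) T, a i x = evL c x (DL c (G i)))
    (hG : ∀ i, ∀ j > 0, (G i).coeff j = 0) :
    ∀ l : List (Fin n), l ≠ [] → iterInt T a l = 0 := by
  refine caseL_nonneg T hT n a (-c) (neg_ne_zero.2 hc) (by rw [neg_mul, Complex.exp_neg, hcT, inv_one])
    (fun i => invert (G i)) (fun i x hx => ?_) (fun i j hj => ?_)
  · rw [DL_inv, evL_inv, ha i x hx]
  · rw [coeff_inv]; exact hG i _ (by omega)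

lemma alg_L (R : Subalgebra ℂ ℂ[T;T⁻¹]) (g : ℂ[T;T⁻¹]) (hg : g ∈ R) (hns : ∀ a, g ≠ algebraMap ℂ ℂ[T;T⁻¹] a)
    (F : ℂ[T;T⁻¹]) : IsAlgebraic R F := by
  have h1 : IsAlgebraic R (T 1 : ℂ[T;T⁻¹]) := by
    obtain ⟨n, f, hf⟩ := LaurentPolynomial.exists_T_pow g
    refine alg_gen R _ g f n hg ?_ hns
    have : ∀ q : Polynomial ℂ, Polynomial.aeval (T 1 : ℂ[T;T⁻¹]) q = Polynomial.toLaurent q := by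
      intro q
      induction q using Polynomial.induction_on with
      | C a => rw [Polynomial.aeval_C, Polynomial.toLaurent_C]; rfl
      | add p q hp hq => simp [hp, hq]
      | monomial n a ih => rw [pow_succ, ← mul_assoc, map_mul, ih, map_mul Polynomial.toLaurent _ Polynomial.X,
          Polynomial.toLaurent_X, Polynomial.aeval_X]
    rw [this, hf, T_pow]; simp
  have h2 : IsAlgebraic R (T (-1) : ℂ[T;T⁻¹]) := by
    let : Invertible (T 1 : ℂ[T;T⁻¹]) := ⟨T (-1), by rw [← T_add]; simp, by rw [← T_add]; simp⟩
    have : (⅟ (T 1 : ℂ[T;T⁻¹])) = T (-1) := rfl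
    rw [← this]
    exact IsAlgebraic.invOf_iff.2 h1
  have h3 : ∀ j : ℤ, IsAlgebraic R (T j : ℂ[T;T⁻¹]) := by
    intro j
    rcases Int.eq_nat_or_neg j with ⟨n, rfl | rfl⟩
    · have := h1.pow n
      rw [T_pow] at this; simpa using this
    · have := h2.pow n
      rw [T_pow] at this; simpa using this
  induction F using LaurentPolynomial.induction_on' with
  | add p q hp hq => exact hp.add hq
  | C_mul_T j p => exact IsAlgebraic.mul (isAlgebraic_algebraMap (algebraMap ℂ R p)) (h3 j)

lemma c0_zero {r0 r1 : ℤ} (h01 : r0 ≠ r1) (P0 : Pm r0) (P1 : Pm r1) (ζ : ℂ) (hζ : ζ ≠ 0) (g F : ℂ[T;T⁻¹])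
    (hg : rot ζ hζ (P0.ψ g) = P1.ψ g) (hF : rot ζ hζ (P0.ψ F) = P1.ψ F) : (DL 1 g * F).coeff 0 = 0 := by
  have e0 : (rot ζ hζ (P0.ψ (DL 1 g * F) * P0.w)).coeff 0 = r0 * (DL 1 g * F).coeff 0 := by
    rw [rot_coeff, P0.res]; simp
  have e1 := P1.res (DL 1 g * F)
  have e2 : P0.ψ (DL 1 g * F) * P0.w = Eu (P0.ψ g) * P0.ψ F := by rw [P0.chain, map_mul]; ring
  have e3 : P1.ψ (DL 1 g * F) * P1.w = Eu (P1.ψ g) * P1.ψ F := by rw [P1.chain, map_mul]; ring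
  rw [e2, map_mul, ← rot_Eu, hg, hF, ← e3, e1] at e0
  have : ((r1 : ℂ) - r0) * (DL 1 g * F).coeff 0 = 0 := by linear_combination e0
  exact (mul_eq_zero.1 this).resolve_left (sub_ne_zero.2 (by exact_mod_cast h01.symm))

lemma chain_c {r : ℤ} (P : Pm r) (c : ℂ) (hc : c ≠ 0) (v : ℂ[T;T⁻¹]) :
    Eu (P.ψ v) = P.ψ (DL c v) * (algebraMap ℂ LL c⁻¹ * P.w) := by
  rw [P.chain, DL_one c, map_mul, AlgHom.commutes]
  have : algebraMap ℂ LL c * algebraMap ℂ LL c⁻¹ = 1 := by rw [← map_mul, mul_inv_cancel₀ hc, map_one]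
  linear_combination (-(P.ψ (DL 1 v) * P.w)) * this

lemma caseL_two (T : ℝ) (hT : 0 < T) (n : ℕ) (a : Fin n → ℝ → ℂ) (c : ℂ) (hc : c ≠ 0)
    (hcT : Complex.exp (c * T) = 1) (G : Fin n → ℂ[T;T⁻¹])
    (ha : ∀ i, ∀ x ∈ Icc (0:ℝ) T, a i x = evL c x (DL c (G i)))
    (hG : ∀ i, evL c 0 (G i) = 0)
    (hm : ∀ (ps : List (Fin n × ℕ)), (∀ q ∈ ps, 0 < q.2) → ∀ i : Fin n, moment T a ps i = 0)
    (u : ℂ[T;T⁻¹]) (huR : u ∈ Algebra.adjoin ℂ (Set.range G)) (j j' : ℤ) (hj : j < 0) (hj' : 0 < j')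
    (hu : u.coeff j ≠ 0) (hu' : u.coeff j' ≠ 0) :
    ∀ l : List (Fin n), l ≠ [] → iterInt T a l = 0 := by
  set R := Algebra.adjoin ℂ (Set.range G) with hRdef
  have hGR : ∀ i, G i ∈ R := fun i => Algebra.subset_adjoin ⟨i, rfl⟩
  have hmom := moments_int (DL c) (evL c) T hT n a (evL_der c) (D_mul _ c) G ha hG hm
  have hres : ∀ f ∈ R, ∀ g ∈ R, (f * DL 1 g).coeff 0 = 0 := by
    intro f hf g hg
    have h1 := hmom f hf g hg
    rw [int_L c hc T hcT, DL_one c, mul_left_comm, ← Algebra.smul_def] at h1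
    have h2 := (mul_eq_zero.1 h1).resolve_left (by exact_mod_cast hT.ne')
    have h3 : c * (f * DL 1 g).coeff 0 = 0 := h2
    exact (mul_eq_zero.1 h3).resolve_left hc
  obtain ⟨m, k, hm0, hk, hku⟩ := pole u j hj hu
  obtain ⟨m', k', hm0', hk', hku'⟩ := pole (invert u) (-j') (by omega) (by rw [coeff_inv, neg_neg]; exact hu')
  obtain ⟨P0, hP0⟩ := exists_Pm u m m' hm0 hm0' k hk hku
  obtain ⟨Q, hQ⟩ := exists_Pm (invert u) m' m hm0' hm0 k' hk' hku'
  have hP1 : Q.inv.ψ u = tm (m * m') := by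
    rw [Q.inv_ψ, hQ, tm]; congr 2; push_cast; ring
  have hP0' : P0.ψ u = tm (m * m') := by
    rw [hP0, tm]; congr 2
  set P1 := Q.inv
  obtain ⟨ζ, hζ, hconj⟩ := conj_L (by omega) P0 P1 u (m * m') (Nat.mul_pos hm0 hm0') hP0' hP1 R huR hres
  refine words_gen (DL c) (evL c) T hT n a (evL_der c) G ha R hGR ((rot ζ hζ).comp P0.ψ) P1.ψ
    ((rot_inj ζ hζ).comp (P0.inj (by omega))) hconj Eu Eu_ker (rot ζ hζ (algebraMap ℂ LL c⁻¹ * P0.w))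
    (algebraMap ℂ LL c⁻¹ * P1.w) ?_ (chain_c P1 c hc) (fun _ => True) ?_ trivial ?_ ?_
  · intro v
    rw [AlgHom.comp_apply, AlgHom.comp_apply, rot_Eu, chain_c P0 c hc, map_mul]
  · intro F _
    refine alg_L R u huR ?_ F
    intro b hb
    apply hu
    rw [hb]
    have := coeff_CT b 0 j
    rw [if_neg (by omega), T_zero, mul_one] at this
    exact this
  · intro F i _ hF
    have h1 := c0_zero (by omega) P0 P1 ζ hζ (G i) F (hconj _ (hGR i)) hF
    have h2 : (DL c (G i) * F).coeff 0 = 0 := by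
      rw [DL_one c, mul_assoc, ← Algebra.smul_def]
      show c * (DL 1 (G i) * F).coeff 0 = 0
      rw [h1, mul_zero]
    obtain ⟨F', h3, h4⟩ := DL_norm c hc _ h2
    exact ⟨F', trivial, h3, h4⟩
  · intro F _
    exact evL_per c T hcT F

theorem caseL (T : ℝ) (hT : 0 < T) (n : ℕ) (a : Fin n → ℝ → ℂ) (c : ℂ) (hc : c ≠ 0)
    (hcT : Complex.exp (c * T) = 1) (G : Fin n → ℂ[T;T⁻¹])
    (ha : ∀ i, ∀ x ∈ Icc (0:ℝ) T, a i x = evL c x (DL c (G i)))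
    (hG : ∀ i, evL c 0 (G i) = 0)
    (hm : ∀ (ps : List (Fin n × ℕ)), (∀ q ∈ ps, 0 < q.2) → ∀ i : Fin n, moment T a ps i = 0) :
    ∀ l : List (Fin n), l ≠ [] → iterInt T a l = 0 := by
  by_cases h1 : ∀ i, ∀ j < 0, (G i).coeff j = 0
  · exact caseL_nonneg T hT n a c hc hcT G ha h1
  by_cases h2 : ∀ i, ∀ j > 0, (G i).coeff j = 0
  · exact caseL_nonpos T hT n a c hc hcT G ha h2
  push Not at h1 h2
  obtain ⟨i, j, hj, hij⟩ := h1
  obtain ⟨i', j', hj', hij'⟩ := h2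
  have hGR : ∀ i, G i ∈ Algebra.adjoin ℂ (Set.range G) := fun i => Algebra.subset_adjoin ⟨i, rfl⟩
  by_cases h3 : (G i).coeff j' = 0
  · by_cases h4 : (G i').coeff j = 0
    · refine caseL_two T hT n a c hc hcT G ha hG hm (G i + G i') (add_mem (hGR i) (hGR i')) j j' hj hj' ?_ ?_
      · rw [AddMonoidAlgebra.coeff_add, Finsupp.add_apply, h4, add_zero]; exact hij
      · rw [AddMonoidAlgebra.coeff_add, Finsupp.add_apply, h3, zero_add]; exact hij'
    · exact caseL_two T hT n a c hc hcT G ha hG hm _ (hGR i') j j' hj hj' h4 hij'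
  · exact caseL_two T hT n a c hc hcT G ha hG hm _ (hGR i) j j' hj hj' hij h3

end L
end MV

namespace MV
open LaurentPolynomial

section fin

lemma evA_iota (c : ℂ) (x : ℝ) (g : ℂ[T;T⁻¹]) : evA c x (iota g) = evL c x g := by
  induction g using LaurentPolynomial.induction_on' with
  | add p q hp hq => simp only [map_add, hp, hq]
  | C_mul_T j p =>
    rw [evL_CT, map_mul, iota_C, iota_T, map_mul, AlgHom.commutes, evA, lft_T, expu_zpow]; rfl

lemma D_iota (c : ℂ) (g : ℂ[T;T⁻¹]) : D dP c (iota g) = iota (DL c g) := by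
  induction g using LaurentPolynomial.induction_on' with
  | add p q hp hq => simp only [map_add, hp, hq]
  | C_mul_T j p =>
    rw [DL_CT, map_mul iota, map_mul iota, iota_C, iota_T, iota_C, D_mul, D_algebraMap, zero_mul, zero_add]
    have h := D_CT dP c 1 j
    rw [map_one, one_mul] at h
    have h1 : dP (1 : Polynomial ℂ) = 0 := by simp
    rw [h, h1, zero_add]
    have h2 := smul_CT (c * j) (1 : Polynomial ℂ) j
    rw [map_one, one_mul] at h2
    rw [← h2, ← Algebra.smul_def, ← Algebra.smul_def, smul_smul, mul_comm p]

lemma adm_split (T : ℝ) (hT : 0 < T) (c : ℂ) (hc : c ≠ 0) (hcT : Complex.exp (c * T) = 1)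
    (hc' : c = 2 * (Real.pi : ℂ) * Complex.I / T) (f : ℝ → ℂ) (hf : Admissible T f)
    (hm : ∫ x in (0:ℝ)..T, f x = 0) :
    (∃ p : Polynomial ℂ, p.eval 0 = 0 ∧ ∀ x ∈ Icc (0:ℝ) T, f x = (Polynomial.derivative p).eval (x : ℂ)) ∨
    (∃ g : ℂ[T;T⁻¹], evL c 0 g = 0 ∧ ∀ x ∈ Icc (0:ℝ) T, f x = evL c x (DL c g)) := by
  rcases hf with ⟨p, hp⟩ | ⟨s, b, hb⟩
  · left
    obtain ⟨q, hq⟩ := ode_poly 0 _ p le_rfl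
    rw [zero_smul, add_zero] at hq
    refine ⟨q - Polynomial.C (q.eval 0), by simp, fun x hx => ?_⟩
    rw [hp x hx, ← hq]; simp
  · right
    set v : ℂ[T;T⁻¹] := ∑ j ∈ s, C (b j) * LaurentPolynomial.T j with hv
    have hfv : ∀ x ∈ Icc (0:ℝ) T, f x = evL c x v := by
      intro x hx
      rw [hb x hx, hv, map_sum]
      refine Finset.sum_congr rfl fun j _ => ?_
      rw [evL_CT, hc']
      congr 2; ring
    have h1 := int_L c hc T hcT v
    have h2 : ∫ x in (0:ℝ)..T, f x = ∫ x in (0:ℝ)..T, evL c x v := by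
      apply intervalIntegral.integral_congr
      intro x hx
      rw [uIcc_of_le hT.le] at hx
      exact hfv x hx
    rw [← h2, hm] at h1
    have h3 := (mul_eq_zero.1 h1.symm).resolve_left (by exact_mod_cast hT.ne')
    obtain ⟨g, hg, hg0⟩ := DL_norm c hc v h3
    exact ⟨g, hg0, fun x hx => by rw [hg]; exact hfv x hx⟩

theorem all_words (T : ℝ) (hT : 0 < T) (n : ℕ) (a : Fin n → ℝ → ℂ) (hadm : ∀ i, Admissible T (a i))
    (hm : ∀ (ps : List (Fin n × ℕ)), (∀ q ∈ ps, 0 < q.2) → ∀ i : Fin n, moment T a ps i = 0) :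
    ∀ l : List (Fin n), l ≠ [] → iterInt T a l = 0 := by
  obtain ⟨c, hc'⟩ : ∃ c : ℂ, c = 2 * (Real.pi : ℂ) * Complex.I / T := ⟨_, rfl⟩
  have hT' : (T : ℂ) ≠ 0 := by exact_mod_cast hT.ne'
  have hc : c ≠ 0 := by rw [hc']; exact div_ne_zero Complex.two_pi_I_ne_zero hT'
  have hcT : Complex.exp (c * T) = 1 := by
    rw [hc', div_mul_cancel₀ _ hT', Complex.exp_two_pi_mul_I]
  have hs := fun i => adm_split T hT c hc hcT hc' (a i) (hadm i) (by
    have := hm [] (by simp) i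
    simpa [moment] using this)
  have polyD : ∀ (p : Polynomial ℂ) (x : ℝ), evA c x (D dP c (C p)) = (Polynomial.derivative p).eval (x : ℂ) := by
    intro p x
    rw [D_C, evA_C]; rfl
  by_cases hA : ∃ i, ∃ p : Polynomial ℂ, 0 < p.natDegree ∧ p.eval 0 = 0 ∧
      ∀ x ∈ Icc (0:ℝ) T, a i x = (Polynomial.derivative p).eval (x : ℂ)
  · obtain ⟨i0, u, hu, hu0, hua⟩ := hA
    have hex : ∀ i, ∃ g : VV, (i = i0 → g = C u) ∧ (∀ x ∈ Icc (0:ℝ) T, a i x = evA c x (D dP c g)) ∧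
        evA c 0 g = 0 ∧ ((∃ p, g = C p) ∨ ∃ w, g = iota w) := by
      intro i
      by_cases hi : i = i0
      · subst hi
        exact ⟨C u, fun _ => rfl, fun x hx => by rw [polyD]; exact hua x hx, by rw [evA_C]; simpa using hu0,
          Or.inl ⟨u, rfl⟩⟩
      · rcases hs i with ⟨p, hp0, hp⟩ | ⟨g, hg0, hg⟩
        · exact ⟨C p, fun h => absurd h hi, fun x hx => by rw [polyD]; exact hp x hx,
            by rw [evA_C]; simpa using hp0, Or.inl ⟨p, rfl⟩⟩
        · exact ⟨iota g, fun h => absurd h hi, fun x hx => by rw [D_iota, evA_iota]; exact hg x hx,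
            by rw [evA_iota]; exact hg0, Or.inr ⟨g, rfl⟩⟩
    choose G hG1 hG2 hG3 hG4 using hex
    exact caseA T hT n a c hc hcT G hG2 hG3 hm hG4 i0 u (hG1 i0 rfl) hu
  · have hex : ∀ i, ∃ g : ℂ[T;T⁻¹], evL c 0 g = 0 ∧ ∀ x ∈ Icc (0:ℝ) T, a i x = evL c x (DL c g) := by
      intro i
      rcases hs i with ⟨p, hp0, hp⟩ | h
      · have h0 : p.natDegree = 0 := by
          by_contra h
          exact hA ⟨i, p, Nat.pos_of_ne_zero h, hp0, hp⟩
        obtain ⟨b, rfl⟩ := Polynomial.natDegree_eq_zero.1 h0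
        exact ⟨0, map_zero _, fun x hx => by rw [hp x hx]; simp⟩
      · exact h
    choose G hG1 hG2 using hex
    exact caseL T hT n a c hc hcT G hG2 hG1 hm

end fin
end MV

/-- **Remark 3.4 (Theorem 3.3 with `b = 0`).**  If all moments of a tuple `a` of
admissible functions vanish, then all basic iterated integrals of `a` vanish,
i.e. `a` is a universal center. -/
theorem moments_vanish_implies_universal_center
    (T : ℝ) (hT : 0 < T) (n : ℕ) (hn : 1 ≤ n)
    (a : Fin n → ℝ → ℂ) (ha : ∀ i, Admissible T (a i))
    (hm : ∀ (ps : List (Fin n × ℕ)), (∀ q ∈ ps, 0 < q.2) →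
      ∀ i : Fin n, moment T a ps i = 0) :
    ∀ l : List (Fin n), l ≠ [] → iterInt T a l = 0 := by
  exact MV.all_words T hT n a ha hm

end
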